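/- Let R be a commutative Noetherian ring, m_1, …, m_t maximal ideals of R, M a finitely generated R-module of finite dimension d, and a = ∩_{i=1}^t m_i. Then Att_R H^d_a(M) = { p ∈ Assh_R M : there exists 1 ≤ i ≤ t with p ⊆ m_i and ht(m_i/p) = d }. -/

import Mathlib

/- Common definitions: local cohomology modules, cohomological dimension, module dimension,
secondary representations and attached primes. -/

open CategoryTheory TensorProduct

/-- The `i`-th local cohomology module `H^i_a(M)`, as a type with its `R`-module structure. -/
noncomputable def TopLC (R : Type) [CommRing R] (a : Ideal R) (i : ℕ)
    (M : Type) [AddCommGroup M] [Module R M] : Type :=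
  ((localCohomology a i).obj (ModuleCat.of R M))

noncomputable instance (R : Type) [CommRing R] (a : Ideal R) (i : ℕ)
    (M : Type) [AddCommGroup M] [Module R M] : AddCommGroup (TopLC R a i M) :=
  inferInstanceAs (AddCommGroup ((localCohomology a i).obj (ModuleCat.of R M)))

noncomputable instance (R : Type) [CommRing R] (a : Ideal R) (i : ℕ)
    (M : Type) [AddCommGroup M] [Module R M] : Module R (TopLC R a i M) :=
  inferInstanceAs (Module R ((localCohomology a i).obj (ModuleCat.of R M)))

/-- The cohomological dimension `cd_R(a, M) = sup { i | H^i_a(M) ≠ 0 }`,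
with value `⊥` if all local cohomology modules vanish. -/
noncomputable def cohDim (R : Type) [CommRing R] (a : Ideal R)
    (M : Type) [AddCommGroup M] [Module R M] : WithBot ℕ∞ :=
  sSup {n : WithBot ℕ∞ | ∃ i : ℕ, n = (i : ℕ) ∧ Nontrivial (TopLC R a i M)}

/-- The (Krull) dimension of a module, i.e. the Krull dimension of its support. -/
noncomputable def moduleDim (R : Type) [CommRing R]
    (M : Type) [AddCommGroup M] [Module R M] : WithBot ℕ∞ :=
  Order.krullDim (Module.support R M)

/-- `Assh_R M`: the associated primes `p` of `M` with `dim R/p = dim M`. -/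
noncomputable def Assh (R : Type) [CommRing R]
    (M : Type) [AddCommGroup M] [Module R M] : Set (Ideal R) :=
  { p | p ∈ associatedPrimes R M ∧ ringKrullDim (R ⧸ p) = moduleDim R M }

/-- A submodule `S` is secondary if `S ≠ 0` and every `r : R` acts on `S` either
surjectively or nilpotently. -/
def IsSecondarySub (R : Type) [CommRing R] {M : Type} [AddCommGroup M] [Module R M]
    (S : Submodule R M) : Prop :=
  S ≠ ⊥ ∧ ∀ r : R, (∀ m ∈ S, ∃ s ∈ S, r • s = m) ∨ (∃ n : ℕ, ∀ m ∈ S, r ^ n • m = 0)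

/-- A module is representable if it is the (finite) sum of secondary submodules. -/
def IsRepresentable (R : Type) [CommRing R] (M : Type) [AddCommGroup M] [Module R M] : Prop :=
  ∃ (n : ℕ) (S : Fin n → Submodule R M), (∀ i, IsSecondarySub R (S i)) ∧ (⨆ i, S i) = ⊤

/-- A minimal secondary representation: secondary submodules summing to the whole module,
with pairwise distinct attached primes, none contained in the sum of the others. -/
def IsMinimalRep (R : Type) [CommRing R] {M : Type} [AddCommGroup M] [Module R M]
    {n : ℕ} (S : Fin n → Submodule R M) : Prop :=
  (∀ i, IsSecondarySub R (S i)) ∧ (⨆ i, S i) = ⊤ ∧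
    (Function.Injective fun i => (S i).annihilator.radical) ∧
    ∀ j, ¬ (S j ≤ ⨆ i ∈ ({j}ᶜ : Set (Fin n)), S i)

/-- The attached primes of a module: the radicals of the annihilators of the terms of a
minimal secondary representation. -/
def AttachedPrimes (R : Type) [CommRing R] (M : Type) [AddCommGroup M] [Module R M] :
    Set (Ideal R) :=
  { p | ∃ (n : ℕ) (S : Fin n → Submodule R M), IsMinimalRep R S ∧
      ∃ i, p = (S i).annihilator.radical }

/-- `stab b N = ⟨b⟩N = ⋂ₙ bⁿN`. -/
def stab {R M : Type} [CommRing R] [AddCommGroup M] [Module R M]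
    (b : Ideal R) (N : Submodule R M) : Submodule R M :=
  ⨅ n : ℕ, b ^ n • N


namespace LCRel
open Opposite

section
variable {R : Type} [CommRing R] (K : ChainComplex (ModuleCat.{0} R)ᵒᵖ ℕ) (i : ℕ)

/-- The relation between cocycles of the complex of modules opposite to `K` and their
cohomology classes. -/
noncomputable def opRel : Submodule R ((K.X i).unop × (K.homology i).unop) :=
  LinearMap.range ((K.pOpcycles i).unop.hom.prod (K.homologyι i).unop.hom)

variable {K i}

lemma opRel_exact_left : Function.Exact (K.pOpcycles i).unop.hom (K.d (i+1) i).unop.hom := by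
  have h : (ShortComplex.mk (K.d (i+1) i) (K.pOpcycles i) (by simp)).Exact :=
    ShortComplex.exact_of_g_is_cokernel _ (K.opcyclesIsCokernel (i+1) i (by simp))
  have := h.unop
  rw [ShortComplex.moduleCat_exact_iff_range_eq_ker] at this
  exact LinearMap.exact_iff.mpr this.symm

lemma opRel_exact_right : Function.Exact
    (K.fromOpcycles i ((ComplexShape.down ℕ).next i)).unop.hom (K.homologyι i).unop.hom := by
  have h : (ShortComplex.mk (K.homologyι i) (K.fromOpcycles i ((ComplexShape.down ℕ).next i)) (by simp)).Exact :=
    ShortComplex.exact_of_f_is_kernel _ (K.homologyIsKernel i _ rfl)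
  have := h.unop
  rw [ShortComplex.moduleCat_exact_iff_range_eq_ker] at this
  exact LinearMap.exact_iff.mpr this.symm

lemma pOpcycles_unop_injective : Function.Injective (K.pOpcycles i).unop.hom :=
  (ModuleCat.mono_iff_injective _).mp inferInstance

lemma homologyι_unop_surjective : Function.Surjective (K.homologyι i).unop.hom :=
  (ModuleCat.epi_iff_surjective _).mp inferInstance

lemma exists_opRel_of_cocycle (z : (K.X i).unop) (hz : (K.d (i+1) i).unop.hom z = 0) :
    ∃ c, (z, c) ∈ opRel K i := by
  obtain ⟨o, rfl⟩ := (opRel_exact_left z).mp hz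
  exact ⟨_, o, rfl⟩

lemma cocycle_of_opRel {z c} (h : (z, c) ∈ opRel K i) : (K.d (i+1) i).unop.hom z = 0 := by
  obtain ⟨o, ho⟩ := h
  obtain rfl : _ = z := congrArg Prod.fst ho
  exact opRel_exact_left.apply_apply_eq_zero o

lemma opRel_zero_left {c} (h : (0, c) ∈ opRel K i) : c = 0 := by
  obtain ⟨o, ho⟩ := h
  have h0 : o = 0 := pOpcycles_unop_injective ((congrArg Prod.fst ho).trans (map_zero _).symm)
  rw [← show _ = c from congrArg Prod.snd ho, h0]
  exact map_zero _

lemma exists_opRel_of_class (c : (K.homology i).unop) : ∃ z, (z, c) ∈ opRel K i := by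
  obtain ⟨o, rfl⟩ := homologyι_unop_surjective c
  exact ⟨_, o, rfl⟩

lemma opRel_zero_iff (z : (K.X i).unop) : (z, 0) ∈ opRel K i ↔
    ∃ w : (K.X ((ComplexShape.down ℕ).next i)).unop,
      (K.d i ((ComplexShape.down ℕ).next i)).unop.hom w = z := by
  have key : (K.fromOpcycles i ((ComplexShape.down ℕ).next i)).unop ≫ (K.pOpcycles i).unop =
      (K.d i ((ComplexShape.down ℕ).next i)).unop := by
    rw [← unop_comp, K.p_fromOpcycles]
  constructor
  · rintro ⟨o, ho⟩
    obtain ⟨w, hw⟩ := (opRel_exact_right o).mp (congrArg Prod.snd ho)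
    refine ⟨w, ?_⟩
    rw [← key]
    simp only [ModuleCat.hom_comp, LinearMap.comp_apply]
    rw [hw]
    exact congrArg Prod.fst ho
  · rintro ⟨w, rfl⟩
    refine ⟨(K.fromOpcycles i ((ComplexShape.down ℕ).next i)).unop.hom w, ?_⟩
    refine Prod.ext ?_ ?_
    · rw [← key]; rfl
    · exact opRel_exact_right.apply_apply_eq_zero w

lemma opRel_map {L : ChainComplex (ModuleCat.{0} R)ᵒᵖ ℕ} (ψ : K ⟶ L) {z c}
    (h : (z, c) ∈ opRel L i) :
    ((ψ.f i).unop.hom z, (HomologicalComplex.homologyMap ψ i).unop.hom c) ∈ opRel K i := by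
  obtain ⟨o, ho⟩ := h
  obtain rfl : _ = z := congrArg Prod.fst ho
  obtain rfl : _ = c := congrArg Prod.snd ho
  refine ⟨(HomologicalComplex.opcyclesMap ψ i).unop.hom o, Prod.ext ?_ ?_⟩
  · have := congrArg Quiver.Hom.unop (HomologicalComplex.p_opcyclesMap ψ i)
    exact DFunLike.congr_fun (congrArg ModuleCat.Hom.hom this) o
  · have := congrArg Quiver.Hom.unop (HomologicalComplex.homologyι_naturality ψ i)
    exact (DFunLike.congr_fun (congrArg ModuleCat.Hom.hom this) o).symm

end

section
variable {R : Type} [CommRing R]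

/-- The contravariant functor `Hom(-, Y)` as a covariant functor to the opposite category. -/
noncomputable abbrev homTo (Y : ModuleCat.{0} R) : ModuleCat.{0} R ⥤ (ModuleCat.{0} R)ᵒᵖ :=
  ((linearYoneda R (ModuleCat.{0} R)).obj Y).rightOp

/-- The complex `Hom(P, Y)`, with values in the opposite category. -/
noncomputable abbrev homComplex (P : ChainComplex (ModuleCat.{0} R) ℕ) (Y : ModuleCat.{0} R) :
    ChainComplex (ModuleCat.{0} R)ᵒᵖ ℕ :=
  ((homTo Y).mapHomologicalComplex _).obj P

variable {X X' : ModuleCat.{0} R} (P : ProjectiveResolution X) (P' : ProjectiveResolution X')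
  (i : ℕ) (Y Y' : ModuleCat.{0} R)

/-- The relation between cocycles and classes in `Ext`. -/
noncomputable def extRel : Submodule R
    ((P.complex.X i ⟶ Y) × (((Ext R (ModuleCat.{0} R) i).obj (op X)).obj Y)) :=
  (opRel (homComplex P.complex Y) i).map
    (LinearMap.prodMap (LinearMap.id : (P.complex.X i ⟶ Y) →ₗ[R] (P.complex.X i ⟶ Y))
      (P.isoLeftDerivedObj (homTo Y) i).hom.unop.hom)

variable {P P' i Y Y'}

lemma mem_extRel {z : P.complex.X i ⟶ Y} {c : (((Ext R (ModuleCat.{0} R) i).obj (op X)).obj Y)} :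
    (z, c) ∈ extRel P i Y ↔
      (z, (P.isoLeftDerivedObj (homTo Y) i).inv.unop.hom c) ∈ opRel (homComplex P.complex Y) i := by
  have h1 : ∀ x, (P.isoLeftDerivedObj (homTo Y) i).hom.unop.hom
      ((P.isoLeftDerivedObj (homTo Y) i).inv.unop.hom x) = x := fun x => by
    have := congrArg Quiver.Hom.unop (P.isoLeftDerivedObj (homTo Y) i).hom_inv_id
    exact DFunLike.congr_fun (congrArg ModuleCat.Hom.hom this) x
  have h2 : ∀ x, (P.isoLeftDerivedObj (homTo Y) i).inv.unop.hom
      ((P.isoLeftDerivedObj (homTo Y) i).hom.unop.hom x) = x := fun x => by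
    have := congrArg Quiver.Hom.unop (P.isoLeftDerivedObj (homTo Y) i).inv_hom_id
    exact DFunLike.congr_fun (congrArg ModuleCat.Hom.hom this) x
  constructor
  · rintro ⟨⟨z', c'⟩, h, he⟩
    obtain rfl : z' = z := congrArg Prod.fst he
    obtain rfl : _ = c := congrArg Prod.snd he
    exact (congrArg (fun x => (z', x) ∈ opRel (homComplex P.complex Y) i) (h2 c')).mpr h
  · intro h
    exact ⟨_, h, Prod.ext rfl (h1 c)⟩

lemma exists_extRel_of_cocycle (z : P.complex.X i ⟶ Y) (hz : P.complex.d (i + 1) i ≫ z = 0) :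
    ∃ c, (z, c) ∈ extRel P i Y := by
  obtain ⟨c, hc⟩ := exists_opRel_of_cocycle (K := homComplex P.complex Y) (i := i) z hz
  exact ⟨_, _, hc, rfl⟩

lemma cocycle_of_extRel {z : P.complex.X i ⟶ Y} {c} (h : (z, c) ∈ extRel P i Y) :
    P.complex.d (i + 1) i ≫ z = 0 :=
  cocycle_of_opRel (mem_extRel.mp h)

lemma extRel_zero_left {c} (h : ((0 : P.complex.X i ⟶ Y), c) ∈ extRel P i Y) : c = 0 := by
  have h0 := opRel_zero_left (K := homComplex P.complex Y) (mem_extRel.mp h)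
  have := congrArg Quiver.Hom.unop (P.isoLeftDerivedObj (homTo Y) i).hom_inv_id
  have h2 : (P.isoLeftDerivedObj (homTo Y) i).hom.unop.hom
      ((P.isoLeftDerivedObj (homTo Y) i).inv.unop.hom c) = c :=
    DFunLike.congr_fun (congrArg ModuleCat.Hom.hom this) c
  rw [← h2]
  exact (congrArg _ h0).trans (map_zero _)

lemma exists_extRel_of_class (c : (((Ext R (ModuleCat.{0} R) i).obj (op X)).obj Y)) :
    ∃ z, (z, c) ∈ extRel P i Y := by
  obtain ⟨z, hz⟩ := exists_opRel_of_class (K := homComplex P.complex Y)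
    ((P.isoLeftDerivedObj (homTo Y) i).inv.unop.hom c)
  exact ⟨z, mem_extRel.mpr hz⟩

lemma extRel_zero_iff (z : P.complex.X i ⟶ Y) : (z, 0) ∈ extRel P i Y ↔
    ∃ w : P.complex.X ((ComplexShape.down ℕ).next i) ⟶ Y,
      P.complex.d i ((ComplexShape.down ℕ).next i) ≫ w = z := by
  rw [mem_extRel]
  exact (congrArg (fun x => (z, x) ∈ opRel (homComplex P.complex Y) i)
    (map_zero _)).to_iff.trans (opRel_zero_iff (K := homComplex P.complex Y) z)

lemma extRel_map_right (g : Y ⟶ Y') {z : P.complex.X i ⟶ Y} {c} (h : (z, c) ∈ extRel P i Y) :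
    (z ≫ g, ((((Ext R (ModuleCat.{0} R) i).obj (op X)).map g)).hom c) ∈ extRel P i Y' := by
  rw [mem_extRel] at h
  have := opRel_map ((NatTrans.mapHomologicalComplex (((linearYoneda R (ModuleCat.{0} R)).map g).rightOp)
    (ComplexShape.down ℕ)).app P.complex) h
  refine ⟨_, this, Prod.ext rfl ?_⟩
  have e := congrArg Quiver.Hom.unop (P.leftDerived_app_eq
    ((linearYoneda R (ModuleCat.{0} R)).map g).rightOp i)
  exact (DFunLike.congr_fun (congrArg ModuleCat.Hom.hom e) c).symm

lemma extRel_map_left (f : X' ⟶ X) (φ : P'.complex ⟶ P.complex)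
    (w : φ ≫ P.π = P'.π ≫ (ChainComplex.single₀ _).map f)
    {z : P.complex.X i ⟶ Y} {c} (h : (z, c) ∈ extRel P i Y) :
    (φ.f i ≫ z, ((((Ext R (ModuleCat.{0} R) i).map f.op).app Y)).hom c) ∈ extRel P' i Y := by
  rw [mem_extRel] at h
  have := opRel_map (((homTo Y).mapHomologicalComplex (ComplexShape.down ℕ)).map φ) h
  refine ⟨_, this, Prod.ext rfl ?_⟩
  have e := congrArg Quiver.Hom.unop ((homTo Y).leftDerived_map_eq i f φ w)
  exact (DFunLike.congr_fun (congrArg ModuleCat.Hom.hom e) c).symm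

end

section
variable {R : Type} [CommRing R] (a : Ideal R) (i : ℕ)

open Limits localCohomology

/-- The quotient of `R` by a power of `a`, as a bundled module. -/
abbrev powQuot (n : ℕ) : ModuleCat.{0} R := ModuleCat.of R (R ⧸ a ^ n)

/-- The quotient map between the quotients by two powers of `a`. -/
abbrev powFactor {n k : ℕ} (h : n ≤ k) : powQuot a k ⟶ powQuot a n :=
  (ringModIdeals (idealPowersDiagram a)).map (homOfLE h).op

/-- The structure map from `Ext` to local cohomology. -/
noncomputable def extTo (n : ℕ) (Y : ModuleCat.{0} R) :
    ((Ext R (ModuleCat.{0} R) i).obj (op (powQuot a n))).obj Y ⟶ (localCohomology a i).obj Y :=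
  (colimit.ι (diagram (idealPowersDiagram a) i) (op (op n))).app Y

variable {a i}

lemma extTo_naturality (n : ℕ) {Y Y' : ModuleCat.{0} R} (g : Y ⟶ Y') (e) :
    ((localCohomology a i).map g).hom ((extTo a i n Y).hom e) =
      (extTo a i n Y').hom ((((Ext R (ModuleCat.{0} R) i).obj (op (powQuot a n))).map g).hom e) :=
  (DFunLike.congr_fun (congrArg ModuleCat.Hom.hom
    ((colimit.ι (diagram (idealPowersDiagram a) i) (op (op n))).naturality g)) e).symm

lemma extTo_powFactor {n k : ℕ} (h : n ≤ k) (Y : ModuleCat.{0} R) (e) :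
    (extTo a i k Y).hom
      ((((Ext R (ModuleCat.{0} R) i).map (powFactor a h).op).app Y).hom e) =
      (extTo a i n Y).hom e := by
  have := colimit.w (diagram (idealPowersDiagram a) i) (homOfLE h).op.op
  exact DFunLike.congr_fun (congrArg ModuleCat.Hom.hom (congrArg (fun f => NatTrans.app f Y) this)) e

/-- The cocone exhibiting local cohomology of `Y` as a colimit of `Ext` modules. -/
noncomputable def isColimitEval (Y : ModuleCat.{0} R) :
    IsColimit (((evaluation _ _).obj Y).mapCocone
      (colimit.cocone (diagram (idealPowersDiagram a) i))) :=
  isColimitOfPreserves ((evaluation _ _).obj Y) (colimit.isColimit _)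

lemma exists_extTo (Y : ModuleCat.{0} R) (c : (localCohomology a i).obj Y) :
    ∃ n e, (extTo a i n Y).hom e = c := by
  obtain ⟨j, e, he⟩ := Concrete.isColimit_exists_rep _ (isColimitEval (a := a) (i := i) Y) c
  exact ⟨j.unop.unop, e, he⟩

lemma extTo_eq_zero (Y : ModuleCat.{0} R) (n : ℕ) (e) (h : (extTo a i n Y).hom e = 0) :
    ∃ (k : ℕ) (hk : n ≤ k),
      (((Ext R (ModuleCat.{0} R) i).map (powFactor a hk).op).app Y).hom e = 0 := by
  obtain ⟨j, f, g, hfg⟩ := Concrete.isColimit_exists_of_rep_eq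
    (diagram (idealPowersDiagram a) i ⋙ (evaluation _ _).obj Y)
    (isColimitEval (a := a) (i := i) Y) (i := op (op n)) (j := op (op n)) e 0
    (h.trans (map_zero _).symm)
  refine ⟨j.unop.unop, leOfHom f.unop.unop, ?_⟩
  exact hfg.trans (map_zero _)

end
open Opposite Limits localCohomology

section
variable {R : Type} [CommRing R] (a : Ideal R)

/-- A projective resolution of `R ⧸ a ^ n`. -/
noncomputable def res (n : ℕ) : ProjectiveResolution (powQuot a n) :=
  Classical.choice (HasProjectiveResolution.out)

/-- The terms of the chosen projective resolution of `R ⧸ a ^ n`. -/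
abbrev resX (n i : ℕ) : Type := (res a n).complex.X i

/-- The differential of the chosen projective resolution of `R ⧸ a ^ n`. -/
noncomputable def resD (n i : ℕ) : resX a n (i + 1) →ₗ[R] resX a n i :=
  ((res a n).complex.d (i + 1) i).hom

/-- The augmentation of the chosen projective resolution of `R ⧸ a ^ n`. -/
noncomputable def resPi (n : ℕ) : resX a n 0 →ₗ[R] R ⧸ a ^ n :=
  ((res a n).π.f 0).hom

/-- The comparison maps between the chosen resolutions. -/
noncomputable def resTr {n k : ℕ} (h : n ≤ k) (i : ℕ) : resX a k i →ₗ[R] resX a n i :=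
  ((ProjectiveResolution.lift (powFactor a h) (res a k) (res a n)).f i).hom

instance (n i : ℕ) : Module.Projective R (resX a n i) := by
  have := (res a n).projective i
  exact (IsProjective.iff_projective _).mpr this

lemma resD_comp_resTr {n k : ℕ} (h : n ≤ k) (i : ℕ) :
    resD a n i ∘ₗ resTr a h (i + 1) = resTr a h i ∘ₗ resD a k i :=
  congrArg ModuleCat.Hom.hom
    ((ProjectiveResolution.lift (powFactor a h) (res a k) (res a n)).comm (i + 1) i)

lemma resPi_comp_resTr {n k : ℕ} (h : n ≤ k) :
    resPi a n ∘ₗ resTr a h 0 = (powFactor a h).hom ∘ₗ resPi a k :=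
  congrArg ModuleCat.Hom.hom (ProjectiveResolution.lift_commutes_zero (powFactor a h) (res a k) (res a n))

lemma resD_exact (n i : ℕ) : Function.Exact (resD a n (i + 1)) (resD a n i) := by
  have := (res a n).exact_succ i
  rw [ShortComplex.moduleCat_exact_iff_range_eq_ker] at this
  exact LinearMap.exact_iff.mpr this.symm

lemma resPi_exact (n : ℕ) : Function.Exact (resD a n 0) (resPi a n) := by
  have := (res a n).exact₀
  rw [ShortComplex.moduleCat_exact_iff_range_eq_ker] at this
  exact LinearMap.exact_iff.mpr this.symm

lemma resPi_surjective (n : ℕ) : Function.Surjective (resPi a n) :=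
  (ModuleCat.epi_iff_surjective _).mp inferInstance

variable {M N : Type} [AddCommGroup M] [Module R M] [AddCommGroup N] [Module R N]

/-- The map induced on local cohomology by a linear map. -/
noncomputable def lcMap (i : ℕ) (f : M →ₗ[R] N) : TopLC R a i M →ₗ[R] TopLC R a i N :=
  ((localCohomology a i).map (ModuleCat.ofHom f)).hom

lemma lcMap_comp {L : Type} [AddCommGroup L] [Module R L] (i : ℕ) (f : M →ₗ[R] N) (g : N →ₗ[R] L) :
    lcMap a i (g ∘ₗ f) = lcMap a i g ∘ₗ lcMap a i f :=
  congrArg ModuleCat.Hom.hom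
    ((localCohomology a i).map_comp (ModuleCat.ofHom f) (ModuleCat.ofHom g))

lemma lcMap_id (i : ℕ) : lcMap a i (LinearMap.id : M →ₗ[R] M) = LinearMap.id :=
  congrArg ModuleCat.Hom.hom ((localCohomology a i).map_id (ModuleCat.of R M))

variable (M) in
/-- The relation between cocycles on the resolution of `R ⧸ a ^ n` and local cohomology classes. -/
noncomputable def lcRel (i n : ℕ) : Submodule R ((resX a n i →ₗ[R] M) × TopLC R a i M) :=
  (extRel (res a n) i (ModuleCat.of R M)).map
    (LinearMap.prodMap (ModuleCat.homLinearEquiv (S := R)).toLinearMap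
      (extTo a i n (ModuleCat.of R M)).hom)

variable {a}

lemma mem_lcRel {i n : ℕ} {z : resX a n i →ₗ[R] M} {c : TopLC R a i M} :
    (z, c) ∈ lcRel a M i n ↔ ∃ e, (ModuleCat.ofHom z, e) ∈ extRel (res a n) i (ModuleCat.of R M) ∧
      (extTo a i n (ModuleCat.of R M)).hom e = c := by
  constructor
  · rintro ⟨⟨z', e⟩, h, he⟩
    obtain rfl : z'.hom = z := congrArg Prod.fst he
    exact ⟨e, h, congrArg Prod.snd he⟩
  · rintro ⟨e, h, rfl⟩
    exact ⟨(ModuleCat.ofHom z, e), h, rfl⟩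

lemma exists_lcRel_of_class {i : ℕ} (c : TopLC R a i M) : ∃ n z, (z, c) ∈ lcRel a M i n := by
  obtain ⟨n, e, rfl⟩ := exists_extTo (ModuleCat.of R M) c
  obtain ⟨z, hz⟩ := exists_extRel_of_class (P := res a n) e
  exact ⟨n, z.hom, mem_lcRel.mpr ⟨e, hz, rfl⟩⟩

lemma exists_lcRel_of_cocycle {i n : ℕ} (z : resX a n i →ₗ[R] M) (hz : z ∘ₗ resD a n i = 0) :
    ∃ c, (z, c) ∈ lcRel a M i n := by
  obtain ⟨e, he⟩ := exists_extRel_of_cocycle (P := res a n) (ModuleCat.ofHom z)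
    (ModuleCat.hom_ext hz)
  exact ⟨_, mem_lcRel.mpr ⟨e, he, rfl⟩⟩

lemma cocycle_of_lcRel {i n : ℕ} {z : resX a n i →ₗ[R] M} {c} (h : (z, c) ∈ lcRel a M i n) :
    z ∘ₗ resD a n i = 0 := by
  obtain ⟨e, he, -⟩ := mem_lcRel.mp h
  exact congrArg ModuleCat.Hom.hom (cocycle_of_extRel he)

lemma lcRel_unique {i n : ℕ} {z : resX a n i →ₗ[R] M} {c c'} (h : (z, c) ∈ lcRel a M i n)
    (h' : (z, c') ∈ lcRel a M i n) : c = c' := by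
  have h0 := (lcRel a M i n).sub_mem h h'
  rw [Prod.mk_sub_mk, sub_self] at h0
  obtain ⟨e, he, h1⟩ := mem_lcRel.mp h0
  have := extRel_zero_left he
  rw [this, map_zero] at h1
  exact sub_eq_zero.mp h1.symm

lemma lcRel_resTr {i n k : ℕ} (hk : n ≤ k) {z : resX a n i →ₗ[R] M} {c}
    (h : (z, c) ∈ lcRel a M i n) : (z ∘ₗ resTr a hk i, c) ∈ lcRel a M i k := by
  obtain ⟨e, he, rfl⟩ := mem_lcRel.mp h
  refine mem_lcRel.mpr ⟨_, extRel_map_left (powFactor a hk)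
    (ProjectiveResolution.lift (powFactor a hk) (res a k) (res a n))
    (ProjectiveResolution.lift_commutes _ _ _) he, extTo_powFactor hk _ e⟩

lemma lcRel_map {i n : ℕ} (f : M →ₗ[R] N) {z : resX a n i →ₗ[R] M} {c}
    (h : (z, c) ∈ lcRel a M i n) : (f ∘ₗ z, lcMap a i f c) ∈ lcRel a N i n := by
  obtain ⟨e, he, rfl⟩ := mem_lcRel.mp h
  exact mem_lcRel.mpr ⟨_, extRel_map_right (ModuleCat.ofHom f) he,
    (extTo_naturality n (ModuleCat.ofHom f) e).symm⟩

lemma exists_of_lcRel_zero {i n : ℕ} {z : resX a n i →ₗ[R] M} (h : (z, 0) ∈ lcRel a M i n) :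
    ∃ (k : ℕ) (hk : n ≤ k), ∃ w : (res a k).complex.X ((ComplexShape.down ℕ).next i) →ₗ[R] M,
      z ∘ₗ resTr a hk i = w ∘ₗ ((res a k).complex.d i ((ComplexShape.down ℕ).next i)).hom := by
  obtain ⟨e, he, h0⟩ := mem_lcRel.mp h
  obtain ⟨k, hk, h1⟩ := extTo_eq_zero _ _ _ h0
  have h2 := extRel_map_left (powFactor a hk)
    (ProjectiveResolution.lift (powFactor a hk) (res a k) (res a n))
    (ProjectiveResolution.lift_commutes _ _ _) he
  rw [h1, extRel_zero_iff] at h2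
  obtain ⟨w, hw⟩ := h2
  exact ⟨k, hk, w.hom, (congrArg ModuleCat.Hom.hom hw).symm⟩

lemma exists_of_lcRel_zero_succ {i n : ℕ} {z : resX a n (i + 1) →ₗ[R] M}
    (h : (z, 0) ∈ lcRel a M (i + 1) n) :
    ∃ (k : ℕ) (hk : n ≤ k), ∃ w : resX a k i →ₗ[R] M,
      z ∘ₗ resTr a hk (i + 1) = w ∘ₗ resD a k i := by
  have := exists_of_lcRel_zero h
  rw [(ComplexShape.down ℕ).next_eq' (show (ComplexShape.down ℕ).Rel (i+1) i from rfl)] at this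
  exact this

lemma exists_of_lcRel_zero_zero {n : ℕ} {z : resX a n 0 →ₗ[R] M}
    (h : (z, 0) ∈ lcRel a M 0 n) :
    ∃ (k : ℕ) (hk : n ≤ k), z ∘ₗ resTr a hk 0 = 0 := by
  obtain ⟨k, hk, w, hw⟩ := exists_of_lcRel_zero h
  refine ⟨k, hk, ?_⟩
  rw [hw, (res a k).complex.shape _ _ (by simp)]
  ext; simp

lemma lcRel_coboundary {i n : ℕ} (w : resX a n i →ₗ[R] M) :
    (w ∘ₗ resD a n i, 0) ∈ lcRel a M (i + 1) n := by
  refine mem_lcRel.mpr ⟨0, ?_, map_zero _⟩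
  rw [extRel_zero_iff, (ComplexShape.down ℕ).next_eq' (show (ComplexShape.down ℕ).Rel (i+1) i from rfl)]
  exact ⟨ModuleCat.ofHom w, rfl⟩

lemma eq_zero_of_lcRel_coboundary {i n : ℕ} {w : resX a n i →ₗ[R] M} {c}
    (h : (w ∘ₗ resD a n i, c) ∈ lcRel a M (i + 1) n) : c = 0 :=
  lcRel_unique h (lcRel_coboundary w)

lemma smul_eq_zero_of_lcRel {i n : ℕ} {z : resX a n i →ₗ[R] M} {c} (h : (z, c) ∈ lcRel a M i n)
    {r : R} (hr : r ∈ a ^ n) : r • c = 0 := by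
  have hom : Homotopy (r • 𝟙 (res a n).complex) 0 := by
    refine ProjectiveResolution.liftHomotopyZero _ ?_
    refine HomologicalComplex.to_single_hom_ext ?_
    rw [HomologicalComplex.comp_f, HomologicalComplex.smul_f_apply, HomologicalComplex.id_f,
      Linear.smul_comp, Category.id_comp]
    ext x
    change r • resPi a n x = 0
    obtain ⟨y, hy⟩ := Ideal.Quotient.mk_surjective (resPi a n x)
    rw [← hy, Algebra.smul_def, Ideal.Quotient.algebraMap_eq, ← map_mul]
    exact Ideal.Quotient.eq_zero_iff_mem.mpr (Ideal.mul_mem_right _ _ hr)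
  have hz := cocycle_of_lcRel h
  have h1 := (lcRel a M i n).smul_mem r h
  have hc := hom.comm i
  rcases i with _ | i
  · rw [Homotopy.dNext_zero_chainComplex, Homotopy.prevD_chainComplex] at hc
    have hc' : r • (LinearMap.id : resX a n 0 →ₗ[R] resX a n 0) = resD a n 0 ∘ₗ (hom.hom 0 1).hom := by
      have := congrArg ModuleCat.Hom.hom hc
      simp at this
      exact this
    have h2 : r • z = 0 := by
      have : r • z = z ∘ₗ (r • LinearMap.id) := by ext; simp
      rw [this, hc', ← LinearMap.comp_assoc, hz, LinearMap.zero_comp]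
    rw [Prod.smul_mk, h2] at h1
    exact lcRel_unique h1 (lcRel a M 0 n).zero_mem
  · rw [Homotopy.dNext_succ_chainComplex, Homotopy.prevD_chainComplex] at hc
    have hc' : r • (LinearMap.id : resX a n (i+1) →ₗ[R] resX a n (i+1)) =
        (hom.hom i (i+1)).hom ∘ₗ resD a n i + resD a n (i+1) ∘ₗ (hom.hom (i+1) (i+2)).hom := by
      have := congrArg ModuleCat.Hom.hom hc
      simp at this
      exact this
    have h2 : r • z = (z ∘ₗ (hom.hom i (i+1)).hom) ∘ₗ resD a n i := by
      have : r • z = z ∘ₗ (r • LinearMap.id) := by ext; simp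
      rw [this, hc', LinearMap.comp_add, ← LinearMap.comp_assoc, ← LinearMap.comp_assoc, hz,
        LinearMap.zero_comp, add_zero]
    rw [Prod.smul_mk, h2] at h1
    exact eq_zero_of_lcRel_coboundary h1

end

section
variable {R : Type} [CommRing R]

lemma exists_comp_eq_of_exact {P A B C : Type} [AddCommGroup P] [Module R P] [Module.Projective R P]
    [AddCommGroup A] [Module R A] [AddCommGroup B] [Module R B] [AddCommGroup C] [Module R C]
    {f : A →ₗ[R] B} {g : B →ₗ[R] C} (h : Function.Exact f g) (u : P →ₗ[R] B) (hu : g ∘ₗ u = 0) :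
    ∃ v : P →ₗ[R] A, f ∘ₗ v = u := by
  have hr : LinearMap.range f = LinearMap.ker g := (LinearMap.exact_iff.mp h).symm
  obtain ⟨v, hv⟩ := Module.projective_lifting_property f.rangeRestrict
    (u.codRestrict (LinearMap.range f) (fun x => by
      rw [hr]; exact DFunLike.congr_fun hu x)) f.surjective_rangeRestrict
  refine ⟨v, ?_⟩
  ext x
  exact congrArg Subtype.val (DFunLike.congr_fun hv x)

variable {a : Ideal R} {i : ℕ} {A B C : Type} [AddCommGroup A] [Module R A]
    [AddCommGroup B] [Module R B] [AddCommGroup C] [Module R C]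
    {f : A →ₗ[R] B} {g : B →ₗ[R] C}

lemma comp_left_cancel {P : Type} [AddCommGroup P] [Module R P] (hf : Function.Injective f)
    {u v : P →ₗ[R] A} (h : f ∘ₗ u = f ∘ₗ v) : u = v := by
  ext x; exact hf (DFunLike.congr_fun h x)

lemma comp_eq_zero_of_exact {P : Type} [AddCommGroup P] [Module R P] (h : Function.Exact f g)
    (u : P →ₗ[R] A) : g ∘ₗ (f ∘ₗ u) = 0 := by
  ext x; exact h.apply_apply_eq_zero _

/-- A cocycle with trivial image is cohomologous to one coming from the kernel. -/
lemma exists_lcRel_sub (hfg : Function.Exact f g)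
    (hg : Function.Surjective g) {n : ℕ}
    {z : resX a n i →ₗ[R] B} (h : (g ∘ₗ z, 0) ∈ lcRel a C i n) :
    ∃ (k : ℕ) (hk : n ≤ k) (v : resX a k i →ₗ[R] A),
      (z ∘ₗ resTr a hk i - f ∘ₗ v, 0) ∈ lcRel a B i k := by
  rcases i with _ | i
  · obtain ⟨k, hk, h0⟩ := exists_of_lcRel_zero_zero h
    obtain ⟨v, hv⟩ := exists_comp_eq_of_exact hfg (z ∘ₗ resTr a hk 0)
      (by rw [← LinearMap.comp_assoc, h0])
    refine ⟨k, hk, v, ?_⟩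
    rw [hv, sub_self]
    exact (lcRel a B 0 k).zero_mem
  · obtain ⟨k, hk, w, h0⟩ := exists_of_lcRel_zero_succ h
    obtain ⟨w', hw'⟩ := Module.projective_lifting_property g w hg
    obtain ⟨v, hv⟩ := exists_comp_eq_of_exact hfg (z ∘ₗ resTr a hk (i+1) - w' ∘ₗ resD a k i)
      (by rw [LinearMap.comp_sub, ← LinearMap.comp_assoc, h0, ← LinearMap.comp_assoc, hw', sub_self])
    refine ⟨k, hk, v, ?_⟩
    rw [hv, sub_sub_cancel]
    exact lcRel_coboundary w'

lemma lcMap_exact (hf : Function.Injective f) (hfg : Function.Exact f g)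
    (hg : Function.Surjective g) : Function.Exact (lcMap a i f) (lcMap a i g) := by
  intro c
  constructor
  · intro hc
    obtain ⟨n, z, hz⟩ := exists_lcRel_of_class c
    have h1 := lcRel_map g hz
    rw [hc] at h1
    obtain ⟨k, hk, v, hv⟩ := exists_lcRel_sub hfg hg h1
    have h2 := (lcRel a B i k).sub_mem (lcRel_resTr hk hz) hv
    rw [Prod.mk_sub_mk, sub_sub_cancel, sub_zero] at h2
    obtain ⟨α, hα⟩ := exists_lcRel_of_cocycle v (comp_left_cancel hf (by
      rw [← LinearMap.comp_assoc, cocycle_of_lcRel h2, LinearMap.comp_zero]))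
    exact ⟨α, lcRel_unique (lcRel_map f hα) h2⟩
  · rintro ⟨α, rfl⟩
    obtain ⟨n, z, hz⟩ := exists_lcRel_of_class α
    have h := lcRel_map g (lcRel_map f hz)
    rw [comp_eq_zero_of_exact hfg] at h
    exact lcRel_unique h (lcRel a C i n).zero_mem

lemma lcMap_surjective_of_subsingleton (hf : Function.Injective f) (hfg : Function.Exact f g)
    (hg : Function.Surjective g) [Subsingleton (TopLC R a (i + 1) A)] :
    Function.Surjective (lcMap a i g) := by
  intro c
  obtain ⟨n, z, hz⟩ := exists_lcRel_of_class c
  obtain ⟨u, hu⟩ := Module.projective_lifting_property g z hg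
  obtain ⟨v, hv⟩ := exists_comp_eq_of_exact hfg (u ∘ₗ resD a n i)
    (by rw [← LinearMap.comp_assoc, hu, cocycle_of_lcRel hz])
  obtain ⟨α, hα⟩ := exists_lcRel_of_cocycle v (comp_left_cancel hf (by
      rw [← LinearMap.comp_assoc, hv, LinearMap.comp_zero, LinearMap.comp_assoc,
        (resD_exact a n i).linearMap_comp_eq_zero, LinearMap.comp_zero]))
  rw [Subsingleton.elim α 0] at hα
  obtain ⟨k, hk, w, hw⟩ := exists_of_lcRel_zero_succ hα
  obtain ⟨b, hb⟩ := exists_lcRel_of_cocycle (u ∘ₗ resTr a hk i - f ∘ₗ w) (by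
    rw [LinearMap.sub_comp, LinearMap.comp_assoc, ← resD_comp_resTr, ← LinearMap.comp_assoc, ← hv,
      LinearMap.comp_assoc, hw, LinearMap.comp_assoc, sub_self])
  refine ⟨b, ?_⟩
  have h1 := lcRel_map g hb
  rw [LinearMap.comp_sub, comp_eq_zero_of_exact hfg, sub_zero, ← LinearMap.comp_assoc, hu] at h1
  exact lcRel_unique h1 (lcRel_resTr hk hz)

variable (a i f g) in
/-- The graph of the connecting homomorphism. -/
noncomputable def connGraph : Submodule R (TopLC R a i C × TopLC R a (i + 1) A) where
  carrier := {p | ∃ (n : ℕ) (u : resX a n i →ₗ[R] B) (v : resX a n (i + 1) →ₗ[R] A),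
    (g ∘ₗ u, p.1) ∈ lcRel a C i n ∧ u ∘ₗ resD a n i = f ∘ₗ v ∧ (v, p.2) ∈ lcRel a A (i + 1) n}
  zero_mem' := ⟨0, 0, 0, by rw [LinearMap.comp_zero]; exact (lcRel a C i 0).zero_mem, by simp,
    (lcRel a A (i + 1) 0).zero_mem⟩
  smul_mem' := by
    rintro r p ⟨n, u, v, h1, h2, h3⟩
    refine ⟨n, r • u, r • v, ?_, ?_, (lcRel a A (i + 1) n).smul_mem r h3⟩
    · rw [LinearMap.comp_smul]
      exact (lcRel a C i n).smul_mem r h1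
    · rw [LinearMap.comp_smul, LinearMap.smul_comp, h2]
  add_mem' := by
    rintro p q ⟨n, u, v, h1, h2, h3⟩ ⟨n', u', v', h1', h2', h3'⟩
    have hk := le_max_left n n'
    have hk' := le_max_right n n'
    refine ⟨max n n', u ∘ₗ resTr a hk i + u' ∘ₗ resTr a hk' i,
      v ∘ₗ resTr a hk (i+1) + v' ∘ₗ resTr a hk' (i+1), ?_, ?_,
      (lcRel a A (i + 1) _).add_mem (lcRel_resTr hk h3) (lcRel_resTr hk' h3')⟩
    · rw [LinearMap.comp_add]
      exact (lcRel a C i _).add_mem (lcRel_resTr hk h1) (lcRel_resTr hk' h1')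
    · rw [LinearMap.comp_add, LinearMap.add_comp, LinearMap.comp_assoc, LinearMap.comp_assoc,
        ← resD_comp_resTr, ← resD_comp_resTr, ← LinearMap.comp_assoc, ← LinearMap.comp_assoc, h2,
        h2', LinearMap.comp_assoc, LinearMap.comp_assoc]

lemma exists_connGraph (hfg : Function.Exact f g) {α : TopLC R a (i + 1) A}
    (hα : lcMap a (i + 1) f α = 0) : ∃ c, (c, α) ∈ connGraph a i f g := by
  obtain ⟨n, v, hv⟩ := exists_lcRel_of_class α
  have h1 := lcRel_map f hv
  rw [hα] at h1
  obtain ⟨k, hk, u, hu⟩ := exists_of_lcRel_zero_succ h1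
  obtain ⟨c, hc⟩ := exists_lcRel_of_cocycle (g ∘ₗ u) (by
    rw [LinearMap.comp_assoc, ← hu, LinearMap.comp_assoc, comp_eq_zero_of_exact hfg])
  exact ⟨c, k, u, v ∘ₗ resTr a hk (i+1), hc, by rw [← hu, LinearMap.comp_assoc], lcRel_resTr hk hv⟩

lemma connGraph_zero_left (hf : Function.Injective f) (hfg : Function.Exact f g)
    (hg : Function.Surjective g) {α : TopLC R a (i + 1) A}
    (h : (0, α) ∈ connGraph a i f g) : α = 0 := by
  obtain ⟨n, u, v, h1, h2, h3⟩ := h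
  obtain ⟨k, hk, w, hw⟩ := exists_lcRel_sub hfg hg h1
  have h4 := cocycle_of_lcRel hw
  rw [LinearMap.sub_comp, LinearMap.comp_assoc, ← resD_comp_resTr, ← LinearMap.comp_assoc, h2,
    sub_eq_zero, LinearMap.comp_assoc, LinearMap.comp_assoc] at h4
  have h5 := lcRel_resTr hk h3
  rw [comp_left_cancel hf h4] at h5
  exact eq_zero_of_lcRel_coboundary h5

lemma lcMap_mem_connGraph (b : TopLC R a i B) : (lcMap a i g b, 0) ∈ connGraph a i f g := by
  obtain ⟨n, u, hu⟩ := exists_lcRel_of_class b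
  exact ⟨n, u, 0, lcRel_map g hu, by rw [cocycle_of_lcRel hu, LinearMap.comp_zero],
    (lcRel a A (i + 1) n).zero_mem⟩

lemma lcMap_injective_of_surjective (hf : Function.Injective f) (hfg : Function.Exact f g)
    (hg : Function.Surjective g) (h : Function.Surjective (lcMap a i g)) :
    Function.Injective (lcMap a (i + 1) f) := by
  rw [injective_iff_map_eq_zero]
  intro α hα
  obtain ⟨c, hc⟩ := exists_connGraph hfg hα
  obtain ⟨b, rfl⟩ := h c
  have := (connGraph a i f g).sub_mem hc (lcMap_mem_connGraph b)
  rw [Prod.mk_sub_mk, sub_self, sub_zero] at this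
  exact connGraph_zero_left hf hfg hg this

lemma isArtinian_ker_lcMap (hf : Function.Injective f) (hfg : Function.Exact f g)
    (hg : Function.Surjective g) [IsArtinian R (TopLC R a i C)] :
    IsArtinian R (LinearMap.ker (lcMap a (i + 1) f)) := by
  have h1 : IsArtinian R (connGraph a i f g) := by
    refine isArtinian_of_injective ((LinearMap.fst R _ _).domRestrict (connGraph a i f g)) ?_
    rw [injective_iff_map_eq_zero]
    rintro ⟨⟨c, α⟩, h⟩ hc
    obtain rfl : c = 0 := hc
    obtain rfl := connGraph_zero_left hf hfg hg h
    rfl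
  have h2 : IsArtinian R (LinearMap.range ((LinearMap.snd R _ _).domRestrict (connGraph a i f g))) :=
    inferInstance
  have h3 : LinearMap.ker (lcMap a (i + 1) f) ≤
      LinearMap.range ((LinearMap.snd R _ _).domRestrict (connGraph a i f g)) := by
    intro α hα
    obtain ⟨c, hc⟩ := exists_connGraph hfg hα
    exact ⟨⟨_, hc⟩, rfl⟩
  exact isArtinian_of_le h3

variable (a i) in
lemma lcMap_smul (r : R) (f : A →ₗ[R] B) : lcMap a i (r • f) = r • lcMap a i f := by
  ext c
  obtain ⟨n, z, hz⟩ := exists_lcRel_of_class c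
  have h1 := lcRel_map (r • f) hz
  rw [LinearMap.smul_comp] at h1
  exact lcRel_unique h1 ((lcRel a B i n).smul_mem r (lcRel_map f hz))

variable (a i A B) in
lemma lcMap_zero : lcMap a i (0 : A →ₗ[R] B) = 0 := by
  have := lcMap_smul a i (0 : R) (0 : A →ₗ[R] B)
  rwa [zero_smul, zero_smul] at this

lemma exists_pow_smul_eq_zero (c : TopLC R a i A) : ∃ n, ∀ r ∈ a ^ n, r • c = 0 := by
  obtain ⟨n, z, hz⟩ := exists_lcRel_of_class c
  exact ⟨n, fun r hr => smul_eq_zero_of_lcRel hz hr⟩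

variable (a i A) in
lemma subsingleton_of_injective [Module.Injective R A] : Subsingleton (TopLC R a (i + 1) A) := by
  refine subsingleton_of_forall_eq 0 fun c => ?_
  obtain ⟨n, z, hz⟩ := exists_lcRel_of_class c
  have hk : LinearMap.ker (resD a n i) ≤ LinearMap.ker z := by
    rw [LinearMap.exact_iff.mp (resD_exact a n i)]
    rintro _ ⟨x, rfl⟩
    exact DFunLike.congr_fun (cocycle_of_lcRel hz) x
  obtain ⟨w, hw⟩ := Module.Injective.out ((LinearMap.ker (resD a n i)).liftQ (resD a n i) le_rfl)
    (LinearMap.ker_eq_bot.mp (Submodule.ker_liftQ_eq_bot' _ _ rfl))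
    ((LinearMap.ker (resD a n i)).liftQ z hk)
  have : z = w ∘ₗ resD a n i := by
    ext x
    exact (hw (Submodule.Quotient.mk x)).symm
  rw [this] at hz
  exact eq_zero_of_lcRel_coboundary hz

end

section
variable {R : Type} [CommRing R] {a : Ideal R} {A B : Type} [AddCommGroup A] [Module R A]
    [AddCommGroup B] [Module R B]

lemma exists_lcRel_zero (c : TopLC R a 0 A) :
    ∃ (n : ℕ) (z : (R ⧸ a ^ n) →ₗ[R] A), (z ∘ₗ resPi a n, c) ∈ lcRel a A 0 n := by
  obtain ⟨n, z, hz⟩ := exists_lcRel_of_class c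
  have hk : LinearMap.ker (resPi a n) ≤ LinearMap.ker z := by
    rw [LinearMap.exact_iff.mp (resPi_exact a n)]
    rintro _ ⟨x, rfl⟩
    exact DFunLike.congr_fun (cocycle_of_lcRel hz) x
  refine ⟨n, ((LinearMap.ker (resPi a n)).liftQ z hk) ∘ₗ
    ((resPi a n).quotKerEquivOfSurjective (resPi_surjective a n)).symm.toLinearMap, ?_⟩
  convert hz
  ext x
  simp only [LinearMap.comp_apply, LinearEquiv.coe_coe]
  have : ((resPi a n).quotKerEquivOfSurjective (resPi_surjective a n)).symm (resPi a n x) =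
      Submodule.Quotient.mk x := by
    rw [LinearEquiv.symm_apply_eq]; rfl
  rw [this]
  rfl

lemma exists_lcRel_zero_of_hom {n : ℕ} (z : (R ⧸ a ^ n) →ₗ[R] A) :
    ∃ c, (z ∘ₗ resPi a n, c) ∈ lcRel a A 0 n :=
  exists_lcRel_of_cocycle _ (by
    rw [LinearMap.comp_assoc, (resPi_exact a n).linearMap_comp_eq_zero, LinearMap.comp_zero])

lemma hom_ext_one {n : ℕ} {z w : (R ⧸ a ^ n) →ₗ[R] A}
    (h : z (Ideal.Quotient.mk _ 1) = w (Ideal.Quotient.mk _ 1)) : z = w := by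
  ext; exact h

lemma smul_hom_one {n : ℕ} (z : (R ⧸ a ^ n) →ₗ[R] A) {r : R} (hr : r ∈ a ^ n) :
    r • z (Ideal.Quotient.mk _ 1) = 0 := by
  rw [← map_smul, Algebra.smul_def, Ideal.Quotient.algebraMap_eq, ← map_mul, mul_one,
    Ideal.Quotient.eq_zero_iff_mem.mpr hr, map_zero]

lemma exists_hom_one {n : ℕ} (x : A) (hx : ∀ r ∈ a ^ n, r • x = 0) :
    ∃ z : (R ⧸ a ^ n) →ₗ[R] A, z (Ideal.Quotient.mk _ 1) = x :=
  ⟨Submodule.liftQ _ (LinearMap.toSpanSingleton R A x) (fun r hr => hx r hr), one_smul R x⟩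

lemma powFactor_one {n k : ℕ} (h : n ≤ k) :
    (powFactor a h).hom (Ideal.Quotient.mk _ 1) = Ideal.Quotient.mk _ 1 := rfl

lemma lcRel_zero_resTr {n k : ℕ} (hk : n ≤ k) {z : (R ⧸ a ^ n) →ₗ[R] A} {c}
    (h : (z ∘ₗ resPi a n, c) ∈ lcRel a A 0 n) :
    ((z ∘ₗ (powFactor a hk).hom) ∘ₗ resPi a k, c) ∈ lcRel a A 0 k := by
  have := lcRel_resTr hk h
  rw [LinearMap.comp_assoc, resPi_comp_resTr, ← LinearMap.comp_assoc] at this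
  exact this

variable (a A) in
lemma subsingleton_zero (h : ∀ (x : A) (n : ℕ), (∀ r ∈ a ^ n, r • x = 0) → x = 0) :
    Subsingleton (TopLC R a 0 A) := by
  refine subsingleton_of_forall_eq 0 fun c => ?_
  obtain ⟨n, z, hz⟩ := exists_lcRel_zero c
  have : z = 0 := hom_ext_one (h _ n fun r hr => smul_hom_one z hr)
  rw [this, LinearMap.zero_comp] at hz
  exact lcRel_unique hz (lcRel a A 0 n).zero_mem

lemma lcMap_zero_surjective {g : A →ₗ[R] B} (hg : Function.Surjective g)
    (hA : ∀ x : A, ∃ n : ℕ, ∀ r ∈ a ^ n, r • x = 0) : Function.Surjective (lcMap a 0 g) := by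
  intro c
  obtain ⟨n, z, hz⟩ := exists_lcRel_zero c
  obtain ⟨x, hx⟩ := hg (z (Ideal.Quotient.mk _ 1))
  obtain ⟨k, hk⟩ := hA x
  obtain ⟨w, hw⟩ := exists_hom_one (a := a) (n := max n k) x
    (fun r hr => hk r (Ideal.pow_le_pow_right (le_max_right n k) hr))
  obtain ⟨b, hb⟩ := exists_lcRel_zero_of_hom w
  refine ⟨b, ?_⟩
  have h1 := lcRel_map g hb
  have h2 := lcRel_zero_resTr (le_max_left n k) hz
  have : g ∘ₗ w = z ∘ₗ (powFactor a (le_max_left n k)).hom := by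
    refine hom_ext_one ?_
    rw [LinearMap.comp_apply, hw, hx]
    rfl
  rw [← LinearMap.comp_assoc, this] at h1
  exact lcRel_unique h1 h2

lemma nontrivial_zero {x : A} (hx : x ≠ 0) (h : ∀ r ∈ a, r • x = 0) :
    Nontrivial (TopLC R a 0 A) := by
  by_contra hn
  rw [not_nontrivial_iff_subsingleton] at hn
  obtain ⟨z, hz⟩ := exists_hom_one (a := a) (n := 1) x (by rwa [pow_one])
  obtain ⟨c, hc⟩ := exists_lcRel_zero_of_hom z
  rw [Subsingleton.elim c 0] at hc
  obtain ⟨k, hk, h0⟩ := exists_of_lcRel_zero_zero hc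
  rw [LinearMap.comp_assoc, resPi_comp_resTr, ← LinearMap.comp_assoc] at h0
  obtain ⟨y, hy⟩ := resPi_surjective a k (Ideal.Quotient.mk _ 1)
  apply hx
  rw [← hz]
  have := DFunLike.congr_fun h0 y
  simp only [LinearMap.comp_apply, hy] at this
  exact this

variable (a A) in
/-- The relation between torsion elements and local cohomology classes in degree zero. -/
noncomputable def torsionGraph : Submodule R (A × TopLC R a 0 A) where
  carrier := {p | ∃ (n : ℕ) (z : (R ⧸ a ^ n) →ₗ[R] A), (z ∘ₗ resPi a n, p.2) ∈ lcRel a A 0 n ∧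
    z (Ideal.Quotient.mk _ 1) = p.1}
  zero_mem' := ⟨0, 0, (lcRel a A 0 0).zero_mem, rfl⟩
  smul_mem' := by
    rintro r p ⟨n, z, h1, h2⟩
    refine ⟨n, r • z, ?_, by rw [LinearMap.smul_apply, h2]; rfl⟩
    rw [LinearMap.smul_comp]
    exact (lcRel a A 0 n).smul_mem r h1
  add_mem' := by
    rintro p q ⟨n, z, h1, h2⟩ ⟨n', z', h1', h2'⟩
    have hk := le_max_left n n'
    have hk' := le_max_right n n'
    refine ⟨max n n', z ∘ₗ (powFactor a hk).hom + z' ∘ₗ (powFactor a hk').hom, ?_, ?_⟩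
    · rw [LinearMap.add_comp]
      exact (lcRel a A 0 _).add_mem (lcRel_zero_resTr hk h1) (lcRel_zero_resTr hk' h1')
    · rw [LinearMap.add_apply, LinearMap.comp_apply, LinearMap.comp_apply, powFactor_one,
        powFactor_one, h2, h2']
      rfl

variable (a A) in
lemma isArtinian_zero (T : Submodule R A) [IsArtinian R T]
    (h : ∀ (x : A) (n : ℕ), (∀ r ∈ a ^ n, r • x = 0) → x ∈ T) :
    IsArtinian R (TopLC R a 0 A) := by
  have h1 : IsArtinian R (torsionGraph a A) := by
    refine isArtinian_of_injective (((LinearMap.fst R _ _).domRestrict (torsionGraph a A)).codRestrict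
      T ?_) ?_
    · rintro ⟨p, n, z, hz, hp⟩
      exact h p.1 n fun r hr => hp ▸ smul_hom_one z hr
    · rw [injective_iff_map_eq_zero]
      rintro ⟨⟨x, c⟩, n, z, hz, h0⟩ hx
      obtain rfl : x = 0 := congrArg Subtype.val hx
      have hz0 : z = 0 := hom_ext_one h0
      rw [hz0, LinearMap.zero_comp] at hz
      obtain rfl : c = 0 := lcRel_unique hz (lcRel a A 0 n).zero_mem
      rfl
  refine isArtinian_of_surjective _ ((LinearMap.snd R _ _).domRestrict (torsionGraph a A)) fun c => ?_
  obtain ⟨n, z, hz⟩ := exists_lcRel_zero c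
  exact ⟨⟨(_, c), n, z, hz, rfl⟩, rfl⟩

end

section
variable {R : Type} [CommRing R] (a : Ideal R) (A : Type) [AddCommGroup A] [Module R A]

/-- The submodule of elements killed by a power of `a`. -/
def gam : Submodule R A where
  carrier := {x | ∃ n : ℕ, ∀ r ∈ a ^ n, r • x = 0}
  zero_mem' := ⟨0, fun r _ => smul_zero r⟩
  smul_mem' := by
    rintro s x ⟨n, h⟩
    exact ⟨n, fun r hr => by rw [smul_comm, h r hr, smul_zero]⟩
  add_mem' := by
    rintro x y ⟨n, h⟩ ⟨k, h'⟩
    exact ⟨max n k, fun r hr => by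
      rw [smul_add, h r (Ideal.pow_le_pow_right (le_max_left n k) hr),
        h' r (Ideal.pow_le_pow_right (le_max_right n k) hr), add_zero]⟩

variable {a A}

lemma exists_pow_of_le_gam {N : Submodule R A} (hN : N.FG) (h : N ≤ gam a A) :
    ∃ n : ℕ, ∀ r ∈ a ^ n, ∀ x ∈ N, r • x = 0 := by
  induction N, hN using Submodule.fg_induction with
  | singleton x =>
    obtain ⟨n, hn⟩ := h (Submodule.mem_span_singleton_self x)
    refine ⟨n, fun r hr y hy => ?_⟩
    obtain ⟨s, rfl⟩ := Submodule.mem_span_singleton.mp hy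
    rw [smul_comm, hn r hr, smul_zero]
  | sup M₁ M₂ _ _ h1 h2 =>
    obtain ⟨n, hn⟩ := h1 (le_sup_left.trans h)
    obtain ⟨k, hk⟩ := h2 (le_sup_right.trans h)
    refine ⟨max n k, fun r hr x hx => ?_⟩
    obtain ⟨y, hy, z, hz, rfl⟩ := Submodule.mem_sup.mp hx
    rw [smul_add, hn r (Ideal.pow_le_pow_right (le_max_left n k) hr) y hy,
        hk r (Ideal.pow_le_pow_right (le_max_right n k) hr) z hz, add_zero]

lemma gam_injective [IsNoetherianRing R] [Module.Injective R A] : Module.Injective R (gam a A) := by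
  refine Module.Baer.injective fun I f => ?_
  obtain ⟨k, hk⟩ := exists_pow_of_le_gam (a := a) (A := A) (N := LinearMap.range ((gam a A).subtype ∘ₗ f))
    (Module.Finite.iff_fg.mp (Module.Finite.range _))
    (by rintro _ ⟨x, rfl⟩; exact (f x).2)
  obtain ⟨l, hl⟩ := Ideal.exists_pow_inf_eq_pow_smul a (I : Submodule R R)
  have h1 := hl (k + l) (Nat.le_add_left _ _)
  rw [Nat.add_sub_cancel] at h1
  let ι : I →ₗ[R] R ⧸ a ^ (k + l) := (Submodule.mkQ (a ^ (k+l))) ∘ₗ Submodule.subtype I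
  have hker : LinearMap.ker ι ≤ LinearMap.ker ((gam a A).subtype ∘ₗ f) := by
    rintro ⟨x, hx⟩ hxι
    have hx' : x ∈ a ^ (k + l) := (Submodule.Quotient.mk_eq_zero _).mp hxι
    have h2 : x ∈ a ^ k • ((a ^ l • ⊤ : Submodule R R) ⊓ I) := by
      rw [← h1]
      exact ⟨by rw [smul_eq_mul, Ideal.mul_top]; exact hx', hx⟩
    have h3 : x ∈ a ^ k • (I : Submodule R R) :=
      (smul_mono_right (a ^ k) inf_le_right : _ ≤ a ^ k • (I : Submodule R R)) h2
    have key : ∀ y ∈ a ^ k • (I : Submodule R R), ∃ hyI : y ∈ I, f ⟨y, hyI⟩ = 0 := by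
      intro y hy
      refine Submodule.smul_induction_on hy ?_ ?_
      · intro r hr n hn
        refine ⟨I.mul_mem_left r hn, ?_⟩
        have h4 := hk r hr _ ⟨⟨n, hn⟩, rfl⟩
        apply Subtype.ext
        rw [← map_smul] at h4
        exact h4
      · rintro y z ⟨hyI, hy⟩ ⟨hzI, hz⟩
        refine ⟨I.add_mem hyI hzI, ?_⟩
        have : (⟨y + z, I.add_mem hyI hzI⟩ : I) = ⟨y, hyI⟩ + ⟨z, hzI⟩ := rfl
        rw [this, map_add, hy, hz, add_zero]
    rw [LinearMap.mem_ker, LinearMap.comp_apply, (key x h3).2, map_zero]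
  obtain ⟨w, hw⟩ := Module.Injective.out ((LinearMap.ker ι).liftQ ι le_rfl)
    (LinearMap.ker_eq_bot.mp (Submodule.ker_liftQ_eq_bot' _ _ rfl))
    ((LinearMap.ker ι).liftQ ((gam a A).subtype ∘ₗ f) hker)
  refine ⟨LinearMap.toSpanSingleton R (gam a A)
    ⟨w (Ideal.Quotient.mk _ 1), k + l, fun r hr => smul_hom_one w hr⟩, fun x hx => ?_⟩
  apply Subtype.ext
  refine Eq.trans ?_ (hw (Submodule.Quotient.mk ⟨x, hx⟩))
  have : (Submodule.liftQ _ ι le_rfl) (Submodule.Quotient.mk (p := LinearMap.ker ι) ⟨x, hx⟩) =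
      x • (Ideal.Quotient.mk (a ^ (k + l)) 1) := by
    rw [Submodule.liftQ_apply, Algebra.smul_def, Ideal.Quotient.algebraMap_eq, ← map_mul, mul_one]
    rfl
  rw [this, map_smul]
  rfl

variable (R A) in
lemma exists_injective_embedding : ∃ (E : Type) (_ : AddCommGroup E) (_ : Module R E) (f : A →ₗ[R] E),
    Module.Injective R E ∧ Function.Injective f := by
  let p := Classical.choice (EnoughInjectives.presentation (ModuleCat.of R A))
  refine ⟨p.J, inferInstance, inferInstance, p.f.hom,
    (Module.injective_iff_injective_object R p.J).mpr p.injective,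
    (ModuleCat.mono_iff_injective _).mp p.mono⟩

variable (a) in
theorem subsingleton_succ_of_torsion [IsNoetherianRing R] (i : ℕ) : ∀ (A : Type) [AddCommGroup A]
    [Module R A], (∀ x : A, x ∈ gam a A) → Subsingleton (TopLC R a (i + 1) A) := by
  induction i with
  | zero =>
    intro A _ _ hA
    obtain ⟨E, _, _, f, hE, hf⟩ := exists_injective_embedding R A
    have := gam_injective (a := a) (A := E)
    let f' : A →ₗ[R] gam a E := f.codRestrict _ (fun x => by
      obtain ⟨n, hn⟩ := hA x
      exact ⟨n, fun r hr => by rw [← map_smul, hn r hr, map_zero]⟩)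
    have hf' : Function.Injective f' := fun x y h => hf (congrArg Subtype.val h)
    have := subsingleton_of_injective a 0 (gam a E)
    have h := lcMap_injective_of_surjective (a := a) (i := 0) (f := f')
      (g := (LinearMap.range f').mkQ) hf' (LinearMap.exact_map_mkQ_range f')
      (Submodule.mkQ_surjective _) (lcMap_zero_surjective (Submodule.mkQ_surjective _) (by
        rintro ⟨x, n, hn⟩
        exact ⟨n, fun r hr => Subtype.ext (hn r hr)⟩))
    exact h.subsingleton
  | succ i ih =>
    intro A _ _ hA
    obtain ⟨E, _, _, f, hE, hf⟩ := exists_injective_embedding R A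
    have := gam_injective (a := a) (A := E)
    let f' : A →ₗ[R] gam a E := f.codRestrict _ (fun x => by
      obtain ⟨n, hn⟩ := hA x
      exact ⟨n, fun r hr => by rw [← map_smul, hn r hr, map_zero]⟩)
    have hf' : Function.Injective f' := fun x y h => hf (congrArg Subtype.val h)
    have := subsingleton_of_injective a (i + 1) (gam a E)
    have hC := ih (gam a E ⧸ LinearMap.range f') (fun x => by
      obtain ⟨⟨x, n, hn⟩, rfl⟩ := Submodule.mkQ_surjective _ x
      exact ⟨n, fun r hr => by rw [← map_smul]; exact
        (congrArg _ (Subtype.ext (hn r hr))).trans (map_zero _)⟩)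
    have h := lcMap_injective_of_surjective (a := a) (i := i + 1) (f := f')
      (g := (LinearMap.range f').mkQ) hf' (LinearMap.exact_map_mkQ_range f')
      (Submodule.mkQ_surjective _) (fun c => ⟨0, Subsingleton.elim _ _⟩)
    exact h.subsingleton

variable (a A) in
lemma lcMap_mkQ_gam_injective [IsNoetherianRing R] (i : ℕ) :
    Function.Injective (lcMap a (i + 1) (gam a A).mkQ) := by
  have := subsingleton_succ_of_torsion a i (gam a A) (by
    rintro ⟨x, n, hn⟩
    exact ⟨n, fun r hr => Subtype.ext (hn r hr)⟩)
  rw [injective_iff_map_eq_zero]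
  intro c hc
  obtain ⟨b, rfl⟩ := (lcMap_exact (a := a) (i := i + 1) (f := (gam a A).subtype) (g := (gam a A).mkQ)
    Subtype.val_injective (LinearMap.exact_subtype_mkQ _) (Submodule.mkQ_surjective _) c).mp hc
  rw [Subsingleton.elim b 0, map_zero]

lemma gam_quotient_eq_bot [IsNoetherianRing R] : gam a (A ⧸ gam a A) = ⊥ := by
  rw [eq_bot_iff]
  intro y hy
  obtain ⟨x, rfl⟩ := Submodule.mkQ_surjective _ y
  obtain ⟨n, hn⟩ := hy
  rw [Submodule.mem_bot, Submodule.mkQ_apply, Submodule.Quotient.mk_eq_zero]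
  obtain ⟨k, hk⟩ := exists_pow_of_le_gam (a := a) (A := A)
    (N := LinearMap.range ((LinearMap.toSpanSingleton R A x).domRestrict (a ^ n)))
    (Module.Finite.iff_fg.mp (Module.Finite.range _))
    (by
      rintro _ ⟨⟨r, hr⟩, rfl⟩
      have := hn r hr
      rw [← map_smul, Submodule.mkQ_apply, Submodule.Quotient.mk_eq_zero] at this
      exact this)
  refine ⟨k + n, fun r hr => ?_⟩
  rw [pow_add] at hr
  refine Submodule.mul_induction_on hr (fun s hs t ht => ?_) (fun s t hs ht => ?_)
  · rw [mul_smul]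
    exact hk s hs _ ⟨⟨t, ht⟩, rfl⟩
  · rw [add_smul, hs, ht, add_zero]

end

section
variable {R : Type} [CommRing R]

/-- Chains of primes starting in `S` and ending at a prime containing `a` have length less
than `d`. -/
def ChainsLT (a : Ideal R) (S : Set (PrimeSpectrum R)) (d : ℕ) : Prop :=
  ∀ s : LTSeries (PrimeSpectrum R), s.head ∈ S → a ≤ s.last.asIdeal → s.length < d

lemma ChainsLT.mono {a : Ideal R} {S T : Set (PrimeSpectrum R)} {d : ℕ} (h : ChainsLT a T d)
    (hST : S ⊆ T) : ChainsLT a S d := fun s hs => h s (hST hs)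

lemma ChainsLT.of_exists_lt {a : Ideal R} {S T : Set (PrimeSpectrum R)} {d : ℕ}
    (h : ChainsLT a T (d + 1)) (hST : ∀ P ∈ S, ∃ Q ∈ T, Q < P) : ChainsLT a S d := by
  intro s hs hl
  obtain ⟨Q, hQ, hlt⟩ := hST _ hs
  have := h (s.cons Q hlt) (by rwa [RelSeries.head_cons]) (by rwa [RelSeries.last_cons])
  rw [RelSeries.cons_length] at this
  omega

variable {A : Type} [AddCommGroup A] [Module R A]

lemma mem_of_mem_support {P : PrimeSpectrum R} (hP : P ∈ Module.support R A)
    {r : R} (hr : ∀ x : A, r • x = 0) : r ∈ P.asIdeal := by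
  obtain ⟨x, hx⟩ := Module.mem_support_iff_exists_annihilator.mp hP
  exact hx ((Submodule.mem_annihilator_span_singleton x r).mpr (hr x))

lemma exists_associatedPrime_le [IsNoetherianRing R] [Module.Finite R A] {P : PrimeSpectrum R}
    (hP : P ∈ Module.support R A) :
    ∃ Q : PrimeSpectrum R, Q ∈ Module.support R A ∧ Q.asIdeal ∈ associatedPrimes R A ∧ Q ≤ P := by
  obtain ⟨q, hq, hle⟩ := Ideal.exists_minimalPrimes_le (Module.mem_support_iff_of_finite.mp hP)
  exact ⟨⟨q, hq.1.1⟩, Module.mem_support_iff_of_finite.mpr hq.1.2,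
    Module.associatedPrimes.minimalPrimes_annihilator_subset_associatedPrimes R A hq, hle⟩

lemma exists_regular_mem [IsNoetherianRing R] [Module.Finite R A] {a : Ideal R}
    (h : gam a A = ⊥) : ∃ x ∈ a, ∀ y : A, x • y = 0 → y = 0 := by
  by_contra! hc
  have h1 : (a : Set R) ⊆ ⋃ p ∈ associatedPrimes R A, (p : Set R) := by
    intro x hx
    rw [biUnion_associatedPrimes_eq_zero_divisors]
    obtain ⟨y, hy, h0⟩ := hc x hx
    exact ⟨y, h0, hy⟩
  obtain ⟨p, hp, hap⟩ := (Ideal.subset_union_prime_finite (associatedPrimes.finite R A)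
    (f := id) 0 0 fun _ h _ _ ↦ h.isPrime).mp h1
  obtain ⟨hpp, y, rfl⟩ := isAssociatedPrime_iff.mp hp
  have hy : y ∈ gam a A := ⟨1, fun r hr => by
    rw [pow_one] at hr
    simpa [Submodule.mem_colon_singleton] using hap hr⟩
  rw [h, Submodule.mem_bot] at hy
  apply hpp.ne_top
  rw [hy, Ideal.eq_top_iff_one]
  simp

/-- Multiplication by a scalar. -/
abbrev mulMap (A : Type) [AddCommGroup A] [Module R A] (x : R) : A →ₗ[R] A := x • LinearMap.id

lemma lcMap_mulMap (a : Ideal R) (i : ℕ) (x : R) (c : TopLC R a i A) :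
    lcMap a i (mulMap A x) c = x • c := by
  rw [lcMap_smul, lcMap_id]
  rfl

lemma smul_cokernel (x : R) (y : A ⧸ LinearMap.range (mulMap A x)) : x • y = 0 := by
  obtain ⟨y, rfl⟩ := Submodule.mkQ_surjective _ y
  rw [← map_smul, Submodule.mkQ_apply, Submodule.Quotient.mk_eq_zero]
  exact ⟨y, rfl⟩

lemma support_quotient_subset (N : Submodule R A) :
    Module.support R (A ⧸ N) ⊆ Module.support R A :=
  Module.support_subset_of_surjective N.mkQ N.mkQ_surjective

lemma chainsLT_cokernel [IsNoetherianRing R] [Module.Finite R A] {a : Ideal R} {d : ℕ}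
    (h : ChainsLT a (Module.support R A) (d + 1)) {x : R} (hx : ∀ y : A, x • y = 0 → y = 0) :
    ChainsLT a (Module.support R (A ⧸ LinearMap.range (mulMap A x))) d := by
  refine h.of_exists_lt fun P hP => ?_
  have hxP := mem_of_mem_support hP (smul_cokernel x)
  obtain ⟨Q, hQ, hQa, hle⟩ := exists_associatedPrime_le (support_quotient_subset _ hP)
  refine ⟨Q, hQ, lt_of_le_of_ne hle ?_⟩
  rintro rfl
  have : x ∈ ⋃ p ∈ associatedPrimes R A, (p : Set R) := Set.mem_biUnion hQa hxP
  rw [biUnion_associatedPrimes_eq_zero_divisors] at this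
  obtain ⟨y, hy, h0⟩ := this
  exact hy (hx y h0)

lemma exists_pow_smul_class {a : Ideal R} {i : ℕ} {x : R} (hx : x ∈ a) (c : TopLC R a i A) :
    ∃ n, x ^ n • c = 0 := by
  obtain ⟨n, hn⟩ := exists_pow_smul_eq_zero c
  exact ⟨n, hn _ (Ideal.pow_mem_pow hx n)⟩

lemma mulMap_injective {x : R} (hx : ∀ y : A, x • y = 0 → y = 0) :
    Function.Injective (mulMap A x) :=
  (injective_iff_map_eq_zero _).mpr hx

theorem subsingleton_of_chainsLT [IsNoetherianRing R] (a : Ideal R) (d : ℕ) : ∀ (A : Type)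
    [AddCommGroup A] [Module R A] [Module.Finite R A], ChainsLT a (Module.support R A) d →
    Subsingleton (TopLC R a d A) := by
  induction d with
  | zero =>
    intro A _ _ _ h
    refine subsingleton_zero a A fun x n hx => ?_
    by_contra hx0
    obtain ⟨p, hp, hle⟩ := exists_le_isAssociatedPrime_of_isNoetherianRing R x hx0
    have hpp := hp.isPrime
    have hap : a ≤ p := by
      refine hpp.le_of_pow_le (n := n) fun r hr => hle ?_
      simpa [Submodule.mem_colon_singleton] using hx r hr
    have := h (RelSeries.singleton _ ⟨p, hpp⟩)
      (Module.mem_support_iff_of_finite.mpr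
        (Submodule.annihilator_top (R := R) (M := A) ▸ hp.annihilator_le)) hap
    omega
  | succ d ih =>
    intro A _ _ _ h
    suffices Subsingleton (TopLC R a (d + 1) (A ⧸ gam a A)) from
      (lcMap_mkQ_gam_injective a A d).subsingleton
    have h' := h.mono (support_quotient_subset (gam a A))
    obtain ⟨x, hxa, hx⟩ := exists_regular_mem (gam_quotient_eq_bot (a := a) (A := A))
    have := ih _ (chainsLT_cokernel h' hx)
    have hinj := lcMap_injective_of_surjective (a := a) (i := d) (mulMap_injective hx)
      (LinearMap.exact_map_mkQ_range _) (Submodule.mkQ_surjective _)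
      (fun c => ⟨0, Subsingleton.elim _ _⟩)
    refine subsingleton_of_forall_eq 0 fun c => ?_
    obtain ⟨n, hn⟩ := exists_pow_smul_class hxa c
    induction n with
    | zero => simpa using hn
    | succ n ihn =>
      refine ihn (hinj ?_)
      rw [map_zero, lcMap_mulMap, ← mul_smul, ← pow_succ']
      exact hn

/-- Melkersson's criterion for one element. -/
lemma isArtinian_of_ker_smul {X : Type} [AddCommGroup X] [Module R X] (x : R)
    (hX : ∀ c : X, ∃ n : ℕ, x ^ n • c = 0)
    [IsArtinian R (LinearMap.ker (x • (LinearMap.id : X →ₗ[R] X)))] : IsArtinian R X := by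
  set K := LinearMap.ker (x • (LinearMap.id : X →ₗ[R] X)) with hK
  rw [← monotone_stabilizes_iff_artinian]
  intro f
  let F : ℕ → Submodule R X := fun n => OrderDual.ofDual (f n)
  have hf : ∀ {n k}, n ≤ k → ∀ {y}, y ∈ F k → y ∈ F n := fun h y hy => f.monotone h hy
  let Y (n k : ℕ) : Submodule R K :=
    Submodule.comap K.subtype ((F n).map (x ^ k • (LinearMap.id : X →ₗ[R] X)))
  have memY : ∀ n k (y : K), y ∈ Y n k ↔ ∃ z ∈ F n, x ^ k • z = y :=
    fun n k y => Iff.rfl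
  have hY : ∀ {n n' k k'}, n ≤ n' → k ≤ k' → Y n' k' ≤ Y n k := by
    intro n n' k k' hn hk y hy
    obtain ⟨z, hz, hzy⟩ := (memY _ _ _).mp hy
    refine (memY _ _ _).mpr ⟨x ^ (k' - k) • z, Submodule.smul_mem _ _ (hf hn hz), ?_⟩
    rw [← mul_smul, ← pow_add, Nat.add_sub_cancel' hk, hzy]
  obtain ⟨N, hN⟩ := IsArtinian.monotone_stabilizes
    (⟨fun n => Y n n, fun n k h => hY h h⟩ : ℕ →o (Submodule R K)ᵒᵈ)
  have hN' : ∀ n, N ≤ n → Y N N = Y n n := hN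
  have hcol : ∀ k, ∃ M, ∀ n, M ≤ n → Y M k = Y n k := fun k =>
    IsArtinian.monotone_stabilizes
      (⟨fun n => Y n k, fun n l h => hY h le_rfl⟩ : ℕ →o (Submodule R K)ᵒᵈ)
  choose g hg using hcol
  let M := max N ((Finset.range N).sup g)
  have hM : ∀ n, M ≤ n → ∀ k, Y M k = Y n k := by
    intro n hn k
    rcases lt_or_ge k N with hk | hk
    · have h1 : g k ≤ M := (Finset.le_sup (f := g) (Finset.mem_range.mpr hk)).trans (le_max_right _ _)
      rw [← hg k M h1, ← hg k n (h1.trans hn)]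
    · have hNM : N ≤ M := le_max_left _ _
      have key : ∀ n, N ≤ n → Y n k = Y N N := fun n hn =>
        le_antisymm (hY hn hk) (by
          rw [hN' (max n k) (hn.trans (le_max_left _ _))]
          exact hY (le_max_left _ _) (le_max_right _ _))
      rw [key M hNM, key n (hNM.trans hn)]
  suffices h : ∀ n, M ≤ n → F M ≤ F n from
    ⟨M, fun n hn => le_antisymm (f.monotone hn) (h n hn)⟩
  intro n hn
  have main : ∀ e : ℕ, ∀ y ∈ F M, x ^ e • y = 0 → y ∈ F n := by
    intro e
    induction e with
    | zero =>
      intro y _ h0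
      rw [pow_zero, one_smul] at h0
      rw [h0]; exact Submodule.zero_mem _
    | succ e ih =>
      intro y hy h0
      have hk : x ^ e • y ∈ K := by
        rw [hK, LinearMap.mem_ker, LinearMap.smul_apply, LinearMap.id_apply, ← mul_smul,
          ← pow_succ', h0]
      have hmem : (⟨x ^ e • y, hk⟩ : K) ∈ Y M e := (memY _ _ _).mpr ⟨y, hy, rfl⟩
      rw [hM n hn e] at hmem
      obtain ⟨z, hz, hzy⟩ := (memY _ _ _).mp hmem
      have := ih (y - z) (Submodule.sub_mem _ hy (hf hn hz)) (by
        rw [smul_sub, hzy, sub_self])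
      have h2 := Submodule.add_mem _ this hz
      rwa [sub_add_cancel] at h2
  intro y hy
  obtain ⟨e, he⟩ := hX y
  exact main e y hy he

lemma isArtinian_of_pow_smul [IsNoetherianRing R] {a : Ideal R} (n : ℕ)
    (ha : ∀ P : Ideal R, P.IsPrime → a ≤ P → P.IsMaximal) {T : Type} [AddCommGroup T] [Module R T]
    [Module.Finite R T] (hT : ∀ r ∈ a ^ n, ∀ x : T, r • x = 0) : IsArtinian R T := by
  have : IsArtinianRing (R ⧸ a ^ n) := by
    rw [isArtinianRing_iff_krullDimLE_zero, Ring.krullDimLE_zero_iff]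
    intro J hJ
    have h1 : a ≤ J.comap (Ideal.Quotient.mk (a ^ n)) := by
      refine Ideal.IsPrime.le_of_pow_le (n := n) fun r hr => ?_
      rw [Ideal.mem_comap, Ideal.Quotient.eq_zero_iff_mem.mpr hr]
      exact J.zero_mem
    have := ha _ inferInstance h1
    have h2 := Ideal.map_comap_of_surjective _ Ideal.Quotient.mk_surjective J
    rw [← h2]
    exact (Ideal.map_eq_top_or_isMaximal_of_surjective _ Ideal.Quotient.mk_surjective this).resolve_left
      (by rw [h2]; exact hJ.ne_top)
  have hA : IsArtinian R (R ⧸ a ^ n) :=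
    isArtinian_of_surjective_algebraMap (R := R ⧸ a ^ n) (M := R ⧸ a ^ n) Ideal.Quotient.mk_surjective
  obtain ⟨k, f, hf⟩ := Module.Finite.exists_fin' R T
  let g : (Fin k → R ⧸ a ^ n) →ₗ[R] T := ∑ j, Submodule.liftQ (a ^ n)
    (LinearMap.toSpanSingleton R T (f (Pi.single j 1))) (fun r hr => hT r hr _) ∘ₗ LinearMap.proj j
  refine isArtinian_of_surjective _ g fun y => ?_
  obtain ⟨v, rfl⟩ := hf y
  refine ⟨fun j => Ideal.Quotient.mk _ (v j), ?_⟩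
  conv_rhs => rw [pi_eq_sum_univ' v]
  rw [map_sum, LinearMap.sum_apply]
  refine Finset.sum_congr rfl fun j _ => ?_
  rw [map_smul]
  rfl

theorem isArtinian_lc [IsNoetherianRing R] (a : Ideal R)
    (ha : ∀ P : Ideal R, P.IsPrime → a ≤ P → P.IsMaximal) (d : ℕ) : ∀ (A : Type)
    [AddCommGroup A] [Module R A] [Module.Finite R A], IsArtinian R (TopLC R a d A) := by
  induction d with
  | zero =>
    intro A _ _ _
    obtain ⟨n, hn⟩ := exists_pow_of_le_gam (IsNoetherian.noetherian (gam a A)) le_rfl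
    have := isArtinian_of_pow_smul n ha (T := gam a A) (fun r hr x => Subtype.ext (hn r hr x x.2))
    exact isArtinian_zero a A (gam a A) fun x n h => ⟨n, h⟩
  | succ d ih =>
    intro A _ _ _
    obtain ⟨x, hxa, hx⟩ := exists_regular_mem (gam_quotient_eq_bot (a := a) (A := A))
    have := ih ((A ⧸ gam a A) ⧸ LinearMap.range (mulMap (A ⧸ gam a A) x))
    have hk := isArtinian_ker_lcMap (a := a) (i := d) (mulMap_injective hx)
      (LinearMap.exact_map_mkQ_range _) (Submodule.mkQ_surjective _)
    rw [lcMap_smul, lcMap_id] at hk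
    have := isArtinian_of_ker_smul (X := TopLC R a (d + 1) (A ⧸ gam a A)) x
      (exists_pow_smul_class hxa)
    exact isArtinian_of_injective _ (lcMap_mkQ_gam_injective a A d)

end

section
variable {R : Type} [CommRing R] [IsNoetherianRing R]
  {A : Type} [AddCommGroup A] [Module R A] [Module.Finite R A]
  {B : Type} [AddCommGroup B] [Module R B] [Module.Finite R B]

theorem lcMap_surjective {a : Ideal R} {d : ℕ} (f : A →ₗ[R] B)
    (hA : ChainsLT a (Module.support R A) (d + 1))
    (hB : ChainsLT a (Module.support R (B ⧸ LinearMap.range f)) d) :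
    Function.Surjective (lcMap a d f) := by
  have h1 := subsingleton_of_chainsLT a (d + 1) (LinearMap.ker f.rangeRestrict)
    (hA.mono (Module.support_subset_of_injective (Submodule.subtype _)
      (Submodule.subtype_injective _)))
  have h2 := subsingleton_of_chainsLT a d _ hB
  have h3 : Function.Surjective (lcMap a d f.rangeRestrict) :=
    lcMap_surjective_of_subsingleton (Submodule.subtype_injective _)
      (LinearMap.exact_subtype_ker_map _) f.surjective_rangeRestrict
  have h4 : Function.Exact (lcMap a d (LinearMap.range f).subtype)
      (lcMap a d (LinearMap.range f).mkQ) :=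
    lcMap_exact (Submodule.subtype_injective _) (LinearMap.exact_subtype_mkQ _)
      (Submodule.mkQ_surjective _)
  have h5 : Function.Surjective (lcMap a d (LinearMap.range f).subtype) :=
    fun c => (h4 c).mp (Subsingleton.elim _ _)
  have h6 := lcMap_comp a d f.rangeRestrict (LinearMap.range f).subtype
  rw [LinearMap.subtype_comp_codRestrict] at h6
  rw [h6]
  exact h5.comp h3

omit [IsNoetherianRing R] in
lemma mem_support_quotient {p : Ideal R} {P : PrimeSpectrum R} :
    P ∈ Module.support R (R ⧸ p) ↔ p ≤ P.asIdeal := by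
  rw [Module.mem_support_iff_of_finite, Ideal.annihilator_quotient]

omit [IsNoetherianRing R] [Module.Finite R B] in
lemma chainsLT_of_smul {a : Ideal R} {d : ℕ} {p : PrimeSpectrum R}
    (hp : ChainsLT a (Set.Ici p) (d + 1)) (hB : Module.support R B ⊆ Set.Ici p)
    {x : R} (hx : x ∉ p.asIdeal) (h : ∀ y : B, x • y = 0) :
    ChainsLT a (Module.support R B) d := by
  refine hp.of_exists_lt fun P hP => ⟨p, Set.mem_Ici.mpr le_rfl, lt_of_le_of_ne (hB hP) ?_⟩
  rintro rfl
  exact hx (mem_of_mem_support hP h)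

lemma smul_surjective {a : Ideal R} {d : ℕ} {p : PrimeSpectrum R}
    (hp : ChainsLT a (Set.Ici p) (d + 1)) (hA : Module.support R A ⊆ Set.Ici p)
    {x : R} (hx : x ∉ p.asIdeal) : Function.Surjective fun c : TopLC R a d A => x • c := by
  have := lcMap_surjective (a := a) (mulMap A x) (hp.mono hA)
    (chainsLT_of_smul hp ((support_quotient_subset _).trans hA) hx (smul_cokernel x))
  intro c
  obtain ⟨b, hb⟩ := this c
  exact ⟨b, by rw [← hb, lcMap_mulMap]⟩

/-- There is a chain of primes of length `d` from `p` to `n`. -/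
def HasChain (p n : PrimeSpectrum R) (d : ℕ) : Prop :=
  ∃ s : LTSeries (PrimeSpectrum R), s.head = p ∧ s.last = n ∧ s.length = d

omit [IsNoetherianRing R] in
lemma HasChain.cons {p q n : PrimeSpectrum R} {d : ℕ} (h : HasChain q n d) (hpq : p < q) :
    HasChain p n (d + 1) := by
  obtain ⟨s, rfl, rfl, rfl⟩ := h
  exact ⟨s.cons p hpq, RelSeries.head_cons .., RelSeries.last_cons .., RelSeries.cons_length ..⟩

omit [IsNoetherianRing R] in
lemma HasChain.le {p n : PrimeSpectrum R} {d : ℕ} (h : HasChain p n d) : p ≤ n := by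
  obtain ⟨s, rfl, rfl, rfl⟩ := h
  exact s.head_le_last

omit [IsNoetherianRing R] in
lemma HasChain.lt {p n : PrimeSpectrum R} {d : ℕ} (h : HasChain p n (d + 1)) : p < n := by
  obtain ⟨s, rfl, rfl, hs⟩ := h
  exact s.strictMono (show (0 : Fin (s.length + 1)) < Fin.last _ by
    rw [Fin.lt_def]; simp [hs])

lemma HasChain.exists_mem {p n : PrimeSpectrum R} {d : ℕ} (h : HasChain p n (d + 1)) {x : R}
    (hx : x ∈ n.asIdeal) : ∃ q, p < q ∧ x ∈ q.asIdeal ∧ HasChain q n d := by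
  obtain ⟨s, rfl, rfl, hs⟩ := h
  obtain ⟨q, hxq, hl, hh, hla⟩ := PrimeSpectrum.exist_ltSeries_mem_one_of_mem_last s hx
  have hq : q.length ≠ 0 := by omega
  refine ⟨q.toFun 1, ?_, hxq, q.tail hq, q.head_tail hq, ?_, ?_⟩
  · rw [hh]
    refine q.strictMono ?_
    have : NeZero q.length := ⟨hq⟩
    rw [Fin.lt_def]
    simp only [Fin.val_one', Fin.val_zero]
    rw [Nat.mod_eq_of_lt (by omega)]
    exact one_pos
  · rw [q.last_tail hq, hla]
  · rw [q.tail_length hq]; omega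

theorem nontrivial_of_hasChain {a : Ideal R}
    (ha : ∀ P : Ideal R, P.IsPrime → a ≤ P → P.IsMaximal) (n : PrimeSpectrum R)
    (hn : a ≤ n.asIdeal) (d : ℕ) : ∀ p : PrimeSpectrum R, HasChain p n d →
    ChainsLT a (Set.Ici p) (d + 1) → Nontrivial (TopLC R a d (R ⧸ p.asIdeal)) := by
  induction d with
  | zero =>
    rintro p ⟨s, rfl, rfl, hs⟩ -
    have : s.last = s.head := congrArg s.toFun (by ext; simp [hs])
    rw [this] at hn
    refine nontrivial_zero (x := Ideal.Quotient.mk s.head.asIdeal 1) ?_ fun r hr => ?_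
    · rw [map_one]; exact one_ne_zero
    · rw [← Ideal.Quotient.mkₐ_eq_mk R, ← map_smul, smul_eq_mul, mul_one,
        Ideal.Quotient.mkₐ_eq_mk, Ideal.Quotient.eq_zero_iff_mem]
      exact hn hr
  | succ d ih =>
    intro p hpn hp
    by_contra hX
    rw [not_nontrivial_iff_subsingleton] at hX
    have hlt : ∀ q, p < q → ChainsLT a (Set.Ici q) (d + 1) := fun q hq =>
      hp.of_exists_lt fun P hP => ⟨p, Set.mem_Ici.mpr le_rfl, hq.trans_le hP⟩
    have hsurj : ∀ q (hq : p < q), Function.Surjective (lcMap a d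
        (Submodule.factor (show p.asIdeal ≤ q.asIdeal from hq.le))) := by
      intro q hq
      set g := Submodule.factor (show p.asIdeal ≤ q.asIdeal from hq.le)
      obtain ⟨y, hyq, hyp⟩ := SetLike.exists_of_lt (show p.asIdeal < q.asIdeal from hq)
      have hy : Submodule.Quotient.mk y ∈ LinearMap.ker g :=
        (Submodule.Quotient.mk_eq_zero _).mpr hyq
      let f : (R ⧸ p.asIdeal) →ₗ[R] LinearMap.ker g :=
        (mulMap (R ⧸ p.asIdeal) y).codRestrict _ fun c => by
          obtain ⟨c, rfl⟩ := Submodule.mkQ_surjective _ c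
          have := (LinearMap.ker g).smul_mem c hy
          rw [← Submodule.Quotient.mk_smul, smul_eq_mul, mul_comm] at this
          exact this
      have hf : Function.Surjective (lcMap a (d + 1) f) := by
        refine lcMap_surjective f (hp.mono fun P hP => mem_support_quotient.mp hP)
          (chainsLT_of_smul hp (fun P hP => mem_support_quotient.mp
            (Module.support_subset_of_injective (Submodule.subtype _)
              (Submodule.subtype_injective _) (support_quotient_subset _ hP))) hyp fun z => ?_)
        obtain ⟨z, rfl⟩ := Submodule.mkQ_surjective _ z
        rw [← map_smul, Submodule.mkQ_apply, Submodule.Quotient.mk_eq_zero]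
        exact ⟨z, rfl⟩
      have := hf.subsingleton
      exact lcMap_surjective_of_subsingleton (Submodule.subtype_injective _)
        (LinearMap.exact_subtype_ker_map _) (Submodule.factor_surjective _)
    rcases d with - | d
    · obtain ⟨q, hpq, -, hq⟩ := hpn.exists_mem (zero_mem _)
      have := ih q hq (hlt q hpq)
      have hap : ¬ a ≤ p.asIdeal := fun h =>
        hpq.ne (PrimeSpectrum.ext ((ha _ p.2 h).eq_of_le q.2.ne_top hpq.le))
      have : Subsingleton (TopLC R a 0 (R ⧸ p.asIdeal)) := by
        refine subsingleton_zero _ _ fun x k hx => ?_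
        obtain ⟨x, rfl⟩ := Ideal.Quotient.mk_surjective x
        rw [Ideal.Quotient.eq_zero_iff_mem]
        by_contra hxp
        refine hap (p.2.le_of_pow_le (n := k) fun r hr => ?_)
        have := hx r hr
        rw [← Ideal.Quotient.mkₐ_eq_mk R, ← map_smul, Ideal.Quotient.mkₐ_eq_mk,
          Ideal.Quotient.eq_zero_iff_mem] at this
        exact (p.2.mem_or_mem this).resolve_right hxp
      have := (hsurj q hpq).subsingleton
      exact not_subsingleton (TopLC R a 0 (R ⧸ q.asIdeal)) this
    · let T := {q : PrimeSpectrum R // p < q ∧ HasChain q n (d + 1)}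
      have := isArtinian_lc a ha (d + 1) (R ⧸ p.asIdeal)
      let K : T → Submodule R (TopLC R a (d + 1) (R ⧸ p.asIdeal)) := fun q =>
        LinearMap.ker (lcMap a (d + 1)
          (Submodule.factor (show p.asIdeal ≤ q.1.asIdeal from q.2.1.le)))
      obtain ⟨F, hF⟩ := Finset.exists_inf_le K
      obtain ⟨x, hxn, hx⟩ : ∃ x ∈ n.asIdeal, ∀ q ∈ F, x ∉ q.1.asIdeal := by
        by_contra! hc
        obtain ⟨q₀, hpq₀, -, hq₀⟩ := hpn.exists_mem (zero_mem _)
        obtain ⟨q, hqF, hq⟩ := (Ideal.subset_union_prime_finite (I := n.asIdeal) F.finite_toSet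
          (f := fun q : T => q.1.asIdeal) ⟨q₀, hpq₀, hq₀⟩ ⟨q₀, hpq₀, hq₀⟩
          fun q _ _ _ => q.1.2).mp fun y hy => by
            obtain ⟨q, hqF, hq⟩ := hc y hy
            exact Set.mem_biUnion hqF hq
        exact (q.2.2.lt).not_ge hq
      obtain ⟨q, hpq, hxq, hq⟩ := hpn.exists_mem hxn
      obtain ⟨r, hrF, hrq⟩ : ∃ r, (∀ q' ∈ F, r ∈ q'.1.asIdeal) ∧ r ∉ q.asIdeal := by
        by_contra! hc
        have : F.inf (fun q' : T => q'.1.asIdeal) ≤ q.asIdeal := fun r hr =>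
          hc r fun q' hq' => Finset.inf_le (f := fun q' : T => q'.1.asIdeal) hq' hr
        obtain ⟨q', hq', hle⟩ := q.2.inf_le'.mp this
        have hlt' : q'.1 < q := lt_of_le_of_ne hle fun h => hx q' hq' (h ▸ hxq)
        obtain ⟨s, hs, hs', hsl⟩ := (hq.cons hlt').cons q'.2.1
        have := hp s (hs ▸ Set.mem_Ici.mpr le_rfl) (hs' ▸ hn)
        omega
      have hq0 : ∀ c : TopLC R a (d + 1) (R ⧸ q.asIdeal), r • c = 0 := by
        intro c
        obtain ⟨c, rfl⟩ := hsurj q hpq c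
        rw [← map_smul]
        refine hF ⟨q, hpq, hq⟩ ?_
        rw [Submodule.mem_finsetInf]
        intro q' hq'
        rw [LinearMap.mem_ker, map_smul, ← lcMap_mulMap]
        have : mulMap (R ⧸ q'.1.asIdeal) r = 0 := by
          ext
          change r • (Submodule.Quotient.mk 1 : R ⧸ q'.1.asIdeal) = 0
          rw [← Submodule.Quotient.mk_smul, Submodule.Quotient.mk_eq_zero, smul_eq_mul, mul_one]
          exact hrF q' hq'
        rw [this, lcMap_zero]
        rfl
      have := ih q hq (hlt q hpq)
      obtain ⟨c, hc⟩ := exists_ne (0 : TopLC R a (d + 1) (R ⧸ q.asIdeal))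
      obtain ⟨b, hb⟩ := smul_surjective (hlt q hpq) (fun P hP => mem_support_quotient.mp hP) hrq c
      exact hc (hb ▸ hq0 b)

end

section
variable {R : Type} [CommRing R]
  {A : Type} [AddCommGroup A] [Module R A]
  {B : Type} [AddCommGroup B] [Module R B]

variable (a : Ideal R) (i : ℕ) in
lemma lcMap_add (f g : A →ₗ[R] B) : lcMap a i (f + g) = lcMap a i f + lcMap a i g := by
  ext c
  obtain ⟨n, z, hz⟩ := exists_lcRel_of_class c
  have h1 := lcRel_map (f + g) hz
  rw [LinearMap.add_comp] at h1
  exact lcRel_unique h1 ((lcRel a B i n).add_mem (lcRel_map f hz) (lcRel_map g hz))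

variable (a : Ideal R) (i : ℕ) in
lemma lcMap_sum {ι : Type*} (s : Finset ι) (f : ι → A →ₗ[R] B) :
    lcMap a i (∑ j ∈ s, f j) = ∑ j ∈ s, lcMap a i (f j) :=
  map_sum (AddMonoidHom.mk' (lcMap a i : (A →ₗ[R] B) → _) (lcMap_add a i)) f s

lemma smul_eq_zero_of_annihilates {a : Ideal R} {i : ℕ} {r : R} (h : ∀ x : A, r • x = 0)
    (c : TopLC R a i A) : r • c = 0 := by
  have : mulMap A r = 0 := LinearMap.ext h
  rw [← lcMap_mulMap, this, lcMap_zero]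
  rfl

lemma exists_hom_quotient_ne_zero [Module.Finite R A] {p : PrimeSpectrum R}
    (hp : p ∈ Module.support R A) : ∃ g : A →ₗ[R] R ⧸ p.asIdeal, g ≠ 0 := by
  classical
  let κ := p.asIdeal.ResidueField
  have : Nontrivial (κ ⊗[R] A) :=
    (Module.mem_support_iff_nontrivial_residueField_tensorProduct p).mp hp
  obtain ⟨v, hv⟩ := exists_ne (0 : κ ⊗[R] A)
  obtain ⟨φ, hφ⟩ : ∃ φ : Module.Dual κ (κ ⊗[R] A), φ v ≠ 0 := by
    by_contra! h
    exact hv ((Module.forall_dual_apply_eq_zero_iff κ v).mp h)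
  let ψ : A →ₗ[R] κ := φ.restrictScalars R ∘ₗ TensorProduct.mk R κ A 1
  have hψ : ∃ x, ψ x ≠ 0 := by
    by_contra! h
    apply hφ
    clear hφ hv
    induction v using TensorProduct.induction_on with
    | zero => exact map_zero _
    | tmul c x =>
      have : c ⊗ₜ[R] x = c • ((1 : κ) ⊗ₜ[R] x) := by
        rw [TensorProduct.smul_tmul', smul_eq_mul, mul_one]
      rw [this, map_smul]
      exact (congrArg (c • ·) (h x)).trans (smul_zero c)
    | add x y hx hy =>
      rw [map_add, hx, hy, add_zero]
  obtain ⟨x, hx⟩ := hψ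
  obtain ⟨k, f, hf⟩ := Module.Finite.exists_fin' R A
  obtain ⟨b, hb⟩ := IsLocalization.exist_integer_multiples (nonZeroDivisors (R ⧸ p.asIdeal))
    (Finset.univ : Finset (Fin k)) fun j => ψ (f (Pi.single j 1))
  obtain ⟨s, hs⟩ := Ideal.Quotient.mk_surjective (b : R ⧸ p.asIdeal)
  have hsκ : ∀ y : κ, s • y = (b : R ⧸ p.asIdeal) • y := by
    intro y
    rw [← hs, ← algebraMap_smul (R ⧸ p.asIdeal) s y]
    rfl
  let ι : (R ⧸ p.asIdeal) →ₗ[R] κ := (Algebra.linearMap (R ⧸ p.asIdeal) κ).restrictScalars R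
  have hι : Function.Injective ι := IsFractionRing.injective (R ⧸ p.asIdeal) κ
  have hmem : ∀ y, (s • ψ) y ∈ LinearMap.range ι := by
    intro y
    obtain ⟨y, rfl⟩ := hf y
    rw [pi_eq_sum_univ' y, map_sum, map_sum]
    refine Submodule.sum_mem _ fun j _ => ?_
    rw [map_smul, map_smul]
    refine Submodule.smul_mem _ _ ?_
    obtain ⟨z, hz⟩ := hb j (Finset.mem_univ j)
    refine ⟨z, hz.trans ?_⟩
    rw [LinearMap.smul_apply, hsκ]
  refine ⟨(LinearEquiv.ofInjective ι hι).symm.toLinearMap ∘ₗ (s • ψ).codRestrict _ hmem, ?_⟩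
  intro h0
  have h1 := LinearMap.congr_fun h0 x
  rw [LinearMap.comp_apply, LinearEquiv.coe_coe, LinearMap.zero_apply,
    LinearEquiv.map_eq_zero_iff] at h1
  have h2 : s • ψ x = 0 := congrArg Subtype.val h1
  rw [hsκ, Algebra.smul_def, mul_eq_zero] at h2
  refine h2.elim (fun h => ?_) hx
  exact nonZeroDivisors.coe_ne_zero b (hι (h.trans (map_zero ι).symm))

lemma exists_pow_smul_of_mem {S : Submodule R A} {r : R} (hr : r ∈ S.annihilator.radical) :
    ∃ n : ℕ, ∀ x ∈ S, r ^ n • x = 0 := by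
  obtain ⟨n, hn⟩ := hr
  exact ⟨n, Submodule.mem_annihilator.mp hn⟩

lemma exists_smul_eq_of_notMem {S : Submodule R A} (hS : IsSecondarySub R S) {r : R}
    (hr : r ∉ S.annihilator.radical) (n : ℕ) : ∀ x ∈ S, ∃ y ∈ S, r ^ n • y = x := by
  have h1 := (hS.2 r).resolve_right fun ⟨n, hn⟩ => hr ⟨n, Submodule.mem_annihilator.mpr hn⟩
  induction n with
  | zero => exact fun x hx => ⟨x, hx, by rw [pow_zero, one_smul]⟩
  | succ n ih =>
    intro x hx
    obtain ⟨y, hy, rfl⟩ := ih x hx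
    obtain ⟨z, hz, rfl⟩ := h1 y hy
    exact ⟨z, hz, by rw [pow_succ, mul_smul]⟩

lemma isPrime_radical_of_isSecondarySub {S : Submodule R A} (hS : IsSecondarySub R S) :
    S.annihilator.radical.IsPrime := by
  refine ⟨fun h => hS.1 ?_, fun {r s} hrs => ?_⟩
  · rwa [Ideal.radical_eq_top, Submodule.annihilator_eq_top_iff] at h
  · rw [or_iff_not_imp_left]
    intro hr
    obtain ⟨n, hn⟩ := exists_pow_smul_of_mem hrs
    refine ⟨n, Submodule.mem_annihilator.mpr fun x hx => ?_⟩
    obtain ⟨y, hy, rfl⟩ := exists_smul_eq_of_notMem hS hr n x hx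
    rw [← mul_smul, mul_comm, ← mul_pow, hn y hy]

lemma exists_uniform_pow {ι : Type*} (F : Finset ι) (r : R) (S : ι → Submodule R A)
    (h : ∀ i ∈ F, ∃ n : ℕ, ∀ x ∈ S i, r ^ n • x = 0) :
    ∃ n : ℕ, ∀ i ∈ F, ∀ x ∈ S i, r ^ n • x = 0 := by
  classical
  choose! n hn using h
  refine ⟨F.sup n, fun i hi x hx => ?_⟩
  rw [← Nat.sub_add_cancel (Finset.le_sup hi : n i ≤ F.sup n), pow_add, mul_smul, hn i hi x hx,
    smul_zero]

/-- The radicals of annihilators in a minimal secondary representation occur in every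
secondary representation. -/
theorem exists_radical_eq {ι : Type*} [Finite ι] {S : ι → Submodule R A}
    (hS : ∀ i, IsSecondarySub R (S i)) (hS' : ⨆ i, S i = ⊤) {n : ℕ} {U : Fin n → Submodule R A}
    (hU : IsMinimalRep R U) (j : Fin n) :
    ∃ i, (S i).annihilator.radical = (U j).annihilator.radical := by
  classical
  have := Fintype.ofFinite ι
  set P := (U j).annihilator.radical
  have hP : P.IsPrime := isPrime_radical_of_isSecondarySub (hU.1 j)
  set V := ⨆ i ∈ ({j}ᶜ : Set (Fin n)), U i
  have hUV : U j ⊔ V = ⊤ := by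
    rw [eq_top_iff, ← hU.2.1]
    refine iSup_le fun i => ?_
    by_cases hi : i = j
    · exact hi ▸ le_sup_left
    · exact (le_iSup₂_of_le (f := fun i (_ : i ∈ ({j}ᶜ : Set (Fin n))) => U i) i hi
        le_rfl).trans le_sup_right
  have hnil : ∀ r ∈ P, ∃ n : ℕ, ∀ x : A, r ^ n • x ∈ V := by
    intro r hr
    obtain ⟨n, hn⟩ := exists_pow_smul_of_mem hr
    refine ⟨n, fun x => ?_⟩
    obtain ⟨u, hu, v, hv, rfl⟩ := Submodule.mem_sup.mp (hUV ▸ Submodule.mem_top : x ∈ U j ⊔ V)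
    rw [smul_add, hn u hu, zero_add]
    exact V.smul_mem _ hv
  have hle : ∀ i, ¬ S i ≤ V → P ≤ (S i).annihilator.radical := by
    intro i hi r hr
    by_contra hri
    obtain ⟨n, hn⟩ := hnil r hr
    refine hi fun x hx => ?_
    obtain ⟨y, -, rfl⟩ := exists_smul_eq_of_notMem (hS i) hri n x hx
    exact hn y
  suffices ∃ i, ¬ S i ≤ V ∧ (S i).annihilator.radical ≤ P by
    obtain ⟨i, h1, h2⟩ := this
    exact ⟨i, le_antisymm h2 (hle i h1)⟩
  by_contra! hc
  let F := Finset.univ.filter fun i => ¬ S i ≤ V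
  obtain ⟨r, hrF, hrP⟩ : ∃ r ∈ F.inf fun i => (S i).annihilator.radical, r ∉ P := by
    by_contra! h
    obtain ⟨i, hi, hi'⟩ := hP.inf_le'.mp h
    exact hc i (Finset.mem_filter.mp hi).2 hi'
  obtain ⟨n, hn⟩ := exists_uniform_pow F r S fun i hi =>
    exists_pow_smul_of_mem (Finset.inf_le (f := fun i => (S i).annihilator.radical) hi hrF)
  have hker : (⊤ : Submodule R A) ≤ V.comap (r ^ n • LinearMap.id) := by
    rw [← hS']
    refine iSup_le fun i x hx => ?_
    change r ^ n • x ∈ V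
    by_cases hi : S i ≤ V
    · exact V.smul_mem _ (hi hx)
    · rw [hn i (Finset.mem_filter.mpr ⟨Finset.mem_univ i, hi⟩) x hx]
      exact V.zero_mem
  refine hU.2.2.2 j fun x hx => ?_
  obtain ⟨y, -, rfl⟩ := exists_smul_eq_of_notMem (hU.1 j) hrP n x hx
  exact hker (Submodule.mem_top : y ∈ _)

/-- An irredundant secondary representation with distinct primes computes the attached primes. -/
theorem attachedPrimes_eq_range {ι : Type*} [Finite ι] {S : ι → Submodule R A}
    (hS : ∀ i, IsSecondarySub R (S i)) (hS' : ⨆ i, S i = ⊤)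
    (hinj : Function.Injective fun i => (S i).annihilator.radical)
    (hirr : ∀ i, ¬ S i ≤ ⨆ j ∈ ({i}ᶜ : Set ι), S j) :
    AttachedPrimes R A = Set.range fun i => (S i).annihilator.radical := by
  ext p
  constructor
  · rintro ⟨n, U, hU, j, rfl⟩
    exact exists_radical_eq hS hS' hU j
  · rintro ⟨i, rfl⟩
    let e := Finite.equivFin ι
    refine ⟨Nat.card ι, fun j => S (e.symm j), ⟨fun j => hS _, ?_, hinj.comp e.symm.injective,
      fun j h => hirr (e.symm j) (h.trans ?_)⟩, e i, by simp⟩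
    · rwa [e.symm.iSup_comp]
    · refine iSup₂_le fun k hk => ?_
      exact le_iSup₂_of_le (f := fun j' (_ : j' ∈ ({e.symm j}ᶜ : Set ι)) => S j') (e.symm k)
        (fun h => hk (e.symm.injective h)) le_rfl

end

section
variable {R : Type} [CommRing R] [IsNoetherianRing R]
  {A : Type} [AddCommGroup A] [Module R A] [Module.Finite R A] {a : Ideal R} {d : ℕ}

/-- Primes in the support from which a chain of length `d` reaches a prime containing `a`. -/
def TopSupport (a : Ideal R) (A : Type) [AddCommGroup A] [Module R A] (d : ℕ) :
    Set (PrimeSpectrum R) :=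
  {p | p ∈ Module.support R A ∧ ∃ n : PrimeSpectrum R, a ≤ n.asIdeal ∧ HasChain p n d}

omit [IsNoetherianRing R] [Module.Finite R A] in
lemma eq_of_le_topSupport (hA : ChainsLT a (Module.support R A) (d + 1)) {p q : PrimeSpectrum R}
    (hp : p ∈ TopSupport a A d) (hq : q ∈ Module.support R A) (hqp : q ≤ p) : q = p := by
  by_contra hne
  obtain ⟨-, n, hn, hc⟩ := hp
  obtain ⟨s, rfl, rfl, hs⟩ := hc.cons (lt_of_le_of_ne hqp hne)
  have := hA s hq hn
  omega

lemma topSupport_associated (hA : ChainsLT a (Module.support R A) (d + 1)) {p : PrimeSpectrum R}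
    (hp : p ∈ TopSupport a A d) : p.asIdeal ∈ associatedPrimes R A := by
  obtain ⟨q, hq, hqa, hqp⟩ := exists_associatedPrime_le hp.1
  exact eq_of_le_topSupport hA hp hq hqp ▸ hqa

lemma topSupport_finite (hA : ChainsLT a (Module.support R A) (d + 1)) :
    (TopSupport a A d).Finite :=
  ((associatedPrimes.finite R A).preimage
    (f := PrimeSpectrum.asIdeal) (fun _ _ _ _ h => PrimeSpectrum.ext h)).subset
    fun _ hp => topSupport_associated hA hp

omit [IsNoetherianRing R] [Module.Finite R A] in
lemma Ici_subset_support {p : PrimeSpectrum R} (hp : p ∈ Module.support R A) :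
    Set.Ici p ⊆ Module.support R A := fun _ h => Module.mem_support_mono h hp

lemma support_gam_subset (p : PrimeSpectrum R) :
    Module.support R (gam p.asIdeal A) ⊆ Set.Ici p := by
  intro P hP
  obtain ⟨n, hn⟩ := exists_pow_of_le_gam (IsNoetherian.noetherian (gam p.asIdeal A)) le_rfl
  exact P.2.le_of_pow_le (n := n) fun r hr =>
    mem_of_mem_support hP fun x => Subtype.ext (hn r hr x x.2)

lemma notMem_support_quotient_gam (hA : ChainsLT a (Module.support R A) (d + 1))
    {p : PrimeSpectrum R} (hp : p ∈ TopSupport a A d) :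
    p ∉ Module.support R (A ⧸ gam p.asIdeal A) := by
  intro h
  obtain ⟨q, hq, hqa, hqp⟩ := exists_associatedPrime_le h
  obtain rfl := eq_of_le_topSupport hA hp (support_quotient_subset _ hq) hqp
  obtain ⟨hpp, y, hy⟩ := isAssociatedPrime_iff.mp hqa
  have hmem : y ∈ gam q.asIdeal (A ⧸ gam q.asIdeal A) := ⟨1, fun r hr => by
    rw [pow_one, hy] at hr
    simpa [Submodule.mem_colon_singleton] using hr⟩
  rw [gam_quotient_eq_bot, Submodule.mem_bot] at hmem
  apply hpp.ne_top
  rw [hy, hmem, Ideal.eq_top_iff_one]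
  simp

/-- The contribution of the `p`-torsion to the top local cohomology. -/
noncomputable def component (a : Ideal R) (A : Type) [AddCommGroup A] [Module R A] (d : ℕ)
    (p : PrimeSpectrum R) : Submodule R (TopLC R a d A) :=
  LinearMap.range (lcMap a d (gam p.asIdeal A).subtype)

lemma component_iSup (hA : ChainsLT a (Module.support R A) (d + 1)) :
    ⨆ p : TopSupport a A d, component a A d p.1 = ⊤ := by
  classical
  have := (topSupport_finite hA).to_subtype
  have := Fintype.ofFinite (TopSupport a A d)
  let N (p : TopSupport a A d) := gam p.1.asIdeal A
  let f : (Π p, N p) →ₗ[R] A := ∑ p, (N p).subtype ∘ₗ LinearMap.proj p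
  have hN : ∀ p, N p ≤ LinearMap.range f := by
    intro p x hx
    refine ⟨Pi.single p ⟨x, hx⟩, ?_⟩
    rw [LinearMap.sum_apply, Finset.sum_eq_single p]
    · simp
    · intro q _ hq
      simp [Pi.single_eq_of_ne hq]
    · simp
  have hsupp : Module.support R (Π p, N p) ⊆ Module.support R A := by
    intro P hP
    rw [Module.mem_support_iff_of_finite] at hP ⊢
    refine le_trans (fun r hr => ?_) hP
    rw [Module.mem_annihilator] at hr ⊢
    exact fun x => funext fun p => Subtype.ext (hr _)
  have hcok : ChainsLT a (Module.support R (A ⧸ LinearMap.range f)) d := by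
    intro s hs hl
    have h1 := hA s (support_quotient_subset _ hs) hl
    by_contra h2
    have hp : s.head ∈ TopSupport a A d :=
      ⟨support_quotient_subset _ hs, s.last, hl, s, rfl, rfl, by omega⟩
    refine notMem_support_quotient_gam hA hp (Module.support_subset_of_surjective
      (Submodule.factor (hN ⟨_, hp⟩)) (Submodule.factor_surjective _) hs)
  have hsurj := lcMap_surjective f (hA.mono hsupp) hcok
  rw [eq_top_iff]
  intro c _
  obtain ⟨b, rfl⟩ := hsurj c
  rw [lcMap_sum, LinearMap.sum_apply]
  refine Submodule.sum_mem _ fun p _ => Submodule.mem_iSup_of_mem p ?_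
  rw [lcMap_comp]
  exact ⟨_, rfl⟩

lemma component_not_le (ha : ∀ P : Ideal R, P.IsPrime → a ≤ P → P.IsMaximal)
    (hA : ChainsLT a (Module.support R A) (d + 1)) (p : TopSupport a A d) :
    ¬ component a A d p.1 ≤ ⨆ q ∈ ({p}ᶜ : Set (TopSupport a A d)), component a A d q.1 := by
  intro hle
  have hpI : ChainsLT a (Set.Ici p.1) (d + 1) := hA.mono (Ici_subset_support p.2.1)
  obtain ⟨g, hg⟩ := exists_hom_quotient_ne_zero p.2.1
  obtain ⟨x, hx⟩ : ∃ x, g x ≠ 0 := by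
    by_contra! h
    exact hg (LinearMap.ext h)
  obtain ⟨y, hy⟩ := Submodule.mkQ_surjective _ (g x)
  have hyp : y ∉ p.1.asIdeal := fun h => hx (by
    rw [← hy, Submodule.mkQ_apply, Submodule.Quotient.mk_eq_zero]
    exact h)
  have hsurj : Function.Surjective (lcMap a d g) := by
    refine lcMap_surjective g hA (chainsLT_of_smul hpI (fun P hP =>
      mem_support_quotient.mp (support_quotient_subset _ hP)) hyp fun z => ?_)
    obtain ⟨z, rfl⟩ := Submodule.mkQ_surjective _ z
    obtain ⟨z, rfl⟩ := Submodule.mkQ_surjective _ z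
    rw [← map_smul, ← map_smul, Submodule.mkQ_apply, Submodule.Quotient.mk_eq_zero, smul_eq_mul,
      mul_comm, ← smul_eq_mul, map_smul, hy, ← map_smul]
    exact ⟨_, rfl⟩
  have hker : ∀ q : TopSupport a A d, q ≠ p →
      component a A d q.1 ≤ LinearMap.ker (lcMap a d g) := by
    rintro q hqp _ ⟨c, rfl⟩
    have hnle : ¬ q.1.asIdeal ≤ p.1.asIdeal := fun h =>
      hqp (Subtype.ext (eq_of_le_topSupport hA p.2 q.2.1 h))
    obtain ⟨r, hrq, hrp⟩ := SetLike.not_le_iff_exists.mp hnle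
    have h0 : g ∘ₗ (gam q.1.asIdeal A).subtype = 0 := by
      ext ⟨u, n, hn⟩
      obtain ⟨w, hw⟩ := Submodule.mkQ_surjective _ (g u)
      have h1 : r ^ n • g u = 0 := by
        rw [← map_smul, hn _ (Ideal.pow_mem_pow hrq n), map_zero]
      rw [← hw, ← map_smul, Submodule.mkQ_apply, Submodule.Quotient.mk_eq_zero] at h1
      change g u = 0
      rw [← hw, Submodule.mkQ_apply, Submodule.Quotient.mk_eq_zero]
      exact (p.1.2.mem_or_mem h1).resolve_left fun h => hrp (p.1.2.mem_of_pow_mem n h)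
    rw [LinearMap.mem_ker, ← LinearMap.comp_apply, ← lcMap_comp, h0, lcMap_zero]
    rfl
  have htop : LinearMap.ker (lcMap a d g) = ⊤ := by
    rw [eq_top_iff, ← component_iSup hA]
    refine iSup_le fun q => ?_
    by_cases hqp : q = p
    · rw [hqp]
      exact hle.trans (iSup₂_le fun q hq => hker q hq)
    · exact hker q hqp
  obtain ⟨-, n, hn, hc⟩ := p.2
  have := nontrivial_of_hasChain ha n hn d p.1 hc hpI
  obtain ⟨c, hc⟩ := exists_ne (0 : TopLC R a d (R ⧸ p.1.asIdeal))
  obtain ⟨b, rfl⟩ := hsurj c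
  exact hc (LinearMap.mem_ker.mp (htop ▸ Submodule.mem_top))

lemma component_ne_bot (ha : ∀ P : Ideal R, P.IsPrime → a ≤ P → P.IsMaximal)
    (hA : ChainsLT a (Module.support R A) (d + 1)) (p : TopSupport a A d) :
    component a A d p.1 ≠ ⊥ := fun h => component_not_le ha hA p (h ▸ bot_le)

lemma component_smul_surjective
    (hA : ChainsLT a (Module.support R A) (d + 1)) (p : TopSupport a A d) {r : R}
    (hr : r ∉ p.1.asIdeal) : ∀ x ∈ component a A d p.1, ∃ y ∈ component a A d p.1, r • y = x := by
  rintro _ ⟨c, rfl⟩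
  obtain ⟨b, rfl⟩ := smul_surjective (hA.mono (Ici_subset_support p.2.1))
    (support_gam_subset (A := A) p.1) hr c
  exact ⟨_, ⟨b, rfl⟩, (map_smul _ _ _).symm⟩

lemma component_pow_smul (p : TopSupport a A d) :
    ∃ n : ℕ, ∀ r ∈ p.1.asIdeal, ∀ x ∈ component a A d p.1, r ^ n • x = 0 := by
  obtain ⟨n, hn⟩ := exists_pow_of_le_gam (IsNoetherian.noetherian (gam p.1.asIdeal A)) le_rfl
  refine ⟨n, ?_⟩
  rintro r hr _ ⟨c, rfl⟩
  rw [← map_smul, smul_eq_zero_of_annihilates (fun x => Subtype.ext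
    (hn _ (Ideal.pow_mem_pow hr n) x x.2)), map_zero]

lemma component_isSecondarySub (ha : ∀ P : Ideal R, P.IsPrime → a ≤ P → P.IsMaximal)
    (hA : ChainsLT a (Module.support R A) (d + 1)) (p : TopSupport a A d) :
    IsSecondarySub R (component a A d p.1) := by
  refine ⟨component_ne_bot ha hA p, fun r => ?_⟩
  by_cases hr : r ∈ p.1.asIdeal
  · obtain ⟨n, hn⟩ := component_pow_smul p
    exact Or.inr ⟨n, hn r hr⟩
  · exact Or.inl (component_smul_surjective hA p hr)

lemma component_radical (ha : ∀ P : Ideal R, P.IsPrime → a ≤ P → P.IsMaximal)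
    (hA : ChainsLT a (Module.support R A) (d + 1)) (p : TopSupport a A d) :
    (component a A d p.1).annihilator.radical = p.1.asIdeal := by
  refine le_antisymm (fun r hr => ?_) fun r hr => ?_
  · by_contra hrp
    obtain ⟨n, hn⟩ := exists_pow_smul_of_mem hr
    refine component_ne_bot ha hA p ((Submodule.eq_bot_iff _).mpr fun x hx => ?_)
    obtain ⟨y, hy, rfl⟩ := component_smul_surjective hA p
      (fun h => hrp (p.1.2.mem_of_pow_mem n h)) x hx
    exact hn y hy
  · obtain ⟨n, hn⟩ := component_pow_smul p
    exact ⟨n, Submodule.mem_annihilator.mpr (hn r hr)⟩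

theorem attachedPrimes_topLC (ha : ∀ P : Ideal R, P.IsPrime → a ≤ P → P.IsMaximal)
    (hA : ChainsLT a (Module.support R A) (d + 1)) :
    AttachedPrimes R (TopLC R a d A) = PrimeSpectrum.asIdeal '' TopSupport a A d := by
  have := (topSupport_finite hA).to_subtype
  rw [attachedPrimes_eq_range (S := fun p : TopSupport a A d => component a A d p.1)
    (component_isSecondarySub ha hA) (component_iSup hA) ?_ (component_not_le ha hA)]
  · simp_rw [component_radical ha hA]
    rw [Set.image_eq_range]
  · intro p q h
    simp only [component_radical ha hA] at h
    exact Subtype.ext (PrimeSpectrum.ext h)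

omit [IsNoetherianRing R] [Module.Finite R A] in
lemma chainsLT_of_moduleDim (hd : moduleDim R A = (d : WithBot ℕ∞)) :
    ChainsLT a (Module.support R A) (d + 1) := by
  intro s hs _
  let s' : LTSeries (Module.support R A) :=
    { length := s.length
      toFun := fun i => ⟨s.toFun i, Module.mem_support_mono (s.head_le i) hs⟩
      step := fun i => s.step i }
  have h := Order.LTSeries.length_le_krullDim s'
  rw [moduleDim] at hd
  rw [hd] at h
  have : s.length ≤ d := by exact_mod_cast h
  omega

theorem topSupport_eq {t : ℕ} {m : Fin t → Ideal R}
    (hmax : ∀ i, (m i).IsMaximal) (hd : moduleDim R A = (d : WithBot ℕ∞)) :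
    PrimeSpectrum.asIdeal '' TopSupport (⨅ i, m i) A d =
      { p | p ∈ Assh R A ∧ ∃ i : Fin t, p ≤ m i ∧
        ∃ hq : ((m i).map (Ideal.Quotient.mk p)).IsPrime,
          Order.height (⟨(m i).map (Ideal.Quotient.mk p), hq⟩ : PrimeSpectrum (R ⧸ p)) =
            (d : ℕ∞) } := by
  have hA : ChainsLT (⨅ i, m i) (Module.support R A) (d + 1) := chainsLT_of_moduleDim hd
  ext p
  constructor
  · rintro ⟨p, hp, rfl⟩
    obtain ⟨-, n, hn, s, rfl, rfl, hs⟩ := id hp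
    obtain ⟨i, -, hi⟩ := s.last.2.inf_le'.mp ((Finset.inf_univ_eq_iInf m).trans_le hn)
    have hlast : s.last.asIdeal = m i := ((hmax i).eq_of_le s.last.2.ne_top hi).symm
    have hpi : s.head.asIdeal ≤ m i := hlast ▸ s.head_le_last
    have hq : ((m i).map (Ideal.Quotient.mk s.head.asIdeal)).IsPrime := by
      have := (hmax i).isPrime
      exact Ideal.map_isPrime_of_surjective Ideal.Quotient.mk_surjective (by rwa [Ideal.mk_ker])
    let f : PrimeSpectrum (R ⧸ s.head.asIdeal) → Module.support R A := fun Q =>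
      ⟨PrimeSpectrum.comap (Ideal.Quotient.mk s.head.asIdeal) Q,
        Module.mem_support_mono (p := s.head) (fun r hr => by
          change Ideal.Quotient.mk _ r ∈ Q.asIdeal
          rw [Ideal.Quotient.eq_zero_iff_mem.mpr hr]
          exact zero_mem _) hp.1⟩
    have hf : StrictMono f := by
      refine Monotone.strictMono_of_injective (fun P Q h => Ideal.comap_mono h) ?_
      intro P Q h
      exact PrimeSpectrum.comap_injective_of_surjective _ Ideal.Quotient.mk_surjective
        (congrArg Subtype.val h)
    have hdim : ringKrullDim (R ⧸ s.head.asIdeal) ≤ (d : WithBot ℕ∞) :=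
      hd ▸ Order.krullDim_le_of_strictMono f hf
    let e := Ideal.primeSpectrumQuotientOrderIsoZeroLocus s.head.asIdeal
    let s' : LTSeries (PrimeSpectrum.zeroLocus (s.head.asIdeal : Set R)) :=
      { length := s.length
        toFun := fun i => ⟨s.toFun i, s.head_le i⟩
        step := fun i => s.step i }
    let s'' := s'.map e.symm e.symm.strictMono
    have hl : s''.last = ⟨(m i).map (Ideal.Quotient.mk s.head.asIdeal), hq⟩ := by
      apply e.injective
      have : s''.last = e.symm s'.last := rfl
      rw [this, OrderIso.apply_symm_apply]
      refine Subtype.ext (PrimeSpectrum.ext ?_)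
      change s.last.asIdeal = Ideal.comap _ _
      rw [Ideal.comap_map_mk hpi, hlast]
    have hge : (d : ℕ∞) ≤ Order.height
        (⟨(m i).map (Ideal.Quotient.mk s.head.asIdeal), hq⟩ : PrimeSpectrum _) := by
      have h := Order.length_le_height_last (p := s'')
      rw [hl] at h
      have : s''.length = d := hs
      rwa [this] at h
    have hle := Order.height_le_krullDim
      (⟨(m i).map (Ideal.Quotient.mk s.head.asIdeal), hq⟩ : PrimeSpectrum _)
    refine ⟨⟨topSupport_associated hA hp, ?_⟩, i, hpi, hq, ?_⟩
    · rw [hd]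
      exact le_antisymm hdim (le_trans (by exact_mod_cast hge) hle)
    · refine le_antisymm ?_ hge
      exact_mod_cast hle.trans hdim
  · rintro ⟨⟨hpA, -⟩, i, hpi, hq, hh⟩
    have hpp := hpA.isPrime
    obtain ⟨s, hs, hsl⟩ := Order.exists_series_of_height_eq_coe _ hh
    have hsupp : (⟨p, hpp⟩ : PrimeSpectrum R) ∈ Module.support R A :=
      Module.mem_support_iff_of_finite.mpr
        (Submodule.annihilator_top (R := R) (M := A) ▸ hpA.annihilator_le)
    have hmono : StrictMono (PrimeSpectrum.comap (Ideal.Quotient.mk p)) :=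
      Monotone.strictMono_of_injective (fun P Q h => Ideal.comap_mono h)
        (PrimeSpectrum.comap_injective_of_surjective _ Ideal.Quotient.mk_surjective)
    let s' := s.map _ hmono
    have hl : s'.last.asIdeal = m i := by
      change Ideal.comap _ s.last.asIdeal = m i
      rw [hs]
      exact Ideal.comap_map_mk hpi
    have hle : (⟨p, hpp⟩ : PrimeSpectrum R) ≤ s'.head := fun r hr => by
      change Ideal.Quotient.mk _ r ∈ s.head.asIdeal
      rw [Ideal.Quotient.eq_zero_iff_mem.mpr hr]
      exact zero_mem _
    have hal : ⨅ i, m i ≤ s'.last.asIdeal := hl ▸ iInf_le m i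
    have htop : s'.head ∈ TopSupport (⨅ i, m i) A d :=
      ⟨Module.mem_support_mono hle hsupp, s'.last, hal, s', rfl, rfl, hsl⟩
    exact ⟨⟨p, hpp⟩, eq_of_le_topSupport hA htop hsupp hle ▸ htop, rfl⟩

omit [IsNoetherianRing R] in
lemma isMaximal_of_iInf_le {t : ℕ} {m : Fin t → Ideal R} (hmax : ∀ i, (m i).IsMaximal)
    (P : Ideal R) (hP : P.IsPrime) (h : ⨅ i, m i ≤ P) : P.IsMaximal := by
  obtain ⟨i, -, hi⟩ := hP.inf_le'.mp ((Finset.inf_univ_eq_iInf m).trans_le h)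
  exact (hmax i).eq_of_le hP.ne_top hi ▸ hmax i

end
end LCRel

/-- For maximal ideals `m_1, …, m_t` of a Noetherian ring `R`, a finitely
generated module `M` of finite dimension `d`, and `a = ∩ᵢ m_i`, one has
`Att_R H^d_a(M) = { p ∈ Assh_R M : ∃ i, p ⊆ m_i ∧ ht(m_i/p) = d }`. -/
theorem stmt_14 (R : Type) [CommRing R] [IsNoetherianRing R] (t : ℕ)
    (m : Fin t → Ideal R) (hmax : ∀ i, (m i).IsMaximal)
    (M : Type) [AddCommGroup M] [Module R M] [Module.Finite R M]
    (d : ℕ) (hd : moduleDim R M = (d : WithBot ℕ∞))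
    (a : Ideal R) (ha : a = ⨅ i, m i) :
    AttachedPrimes R (TopLC R a d M) =
      { p | p ∈ Assh R M ∧ ∃ i : Fin t, p ≤ m i ∧
        ∃ hq : ((m i).map (Ideal.Quotient.mk p)).IsPrime,
          Order.height (⟨(m i).map (Ideal.Quotient.mk p), hq⟩ : PrimeSpectrum (R ⧸ p)) =
            (d : ℕ∞) } := by
  rw [ha, LCRel.attachedPrimes_topLC (LCRel.isMaximal_of_iInf_le hmax)
    (LCRel.chainsLT_of_moduleDim hd)]
  exact LCRel.topSupport_eq hmax hd
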